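/- Let S = {s_1 < s_2 < ⋯ < s_k} ⊆ {1,…,n−1} and let λ be a partition of n. Then the multiplicity b_λ(S) of the irreducible 𝔖_n-representation ρ^λ in β_{P_n}(S) is equal to the number of pairs (w,Q) where w ∈ 𝔖_n has descent set S, Q is a standard Young tableau of shape λ, and τ(w,Q) is odd. -/

import Mathlib

open scoped Classical

noncomputable section

/-! ### Permutation combinatorics -/

/-- The value `w(i)` (1-based, in `{1,…,n}`) of a permutation `w` of `{1,…,n}`,
realized as `Equiv.Perm (Fin n)`. -/
def permApp {n : ℕ} (w : Equiv.Perm (Fin n)) (i : ℕ) : ℕ :=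
  if h : i - 1 < n then (w ⟨i - 1, h⟩ : ℕ) + 1 else 0

/-- The descent set of a permutation, a subset of `{1,…,n-1}`. -/
def descentSet {n : ℕ} (w : Equiv.Perm (Fin n)) : Finset ℕ :=
  (Finset.Icc 1 (n - 1)).filter fun i => permApp w (i + 1) < permApp w i

/-- `numDescentSet m T` is the number of permutations in `𝔖_m` with descent set `T`. -/
def numDescentSet (m : ℕ) (T : Finset ℕ) : ℕ :=
  Nat.card {w : Equiv.Perm (Fin m) // descentSet w = T}

/-- The Coxeter length (number of inversions) of a permutation. -/
def invCount {n : ℕ} (w : Equiv.Perm (Fin n)) : ℕ :=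
  (Finset.univ.filter fun p : Fin n × Fin n => p.1 < p.2 ∧ w p.2 < w p.1).card

/-- For `S = {s_1 < s_2 < ⋯ < s_k} ⊆ {1,…,n-1}`, `sElt n S j = s_j`, with the
conventions `s_0 = 0` and `s_j = n` for `j > k`. -/
def sElt (n : ℕ) (S : Finset ℕ) (j : ℕ) : ℕ :=
  if j = 0 then 0 else if j ≤ S.card then (S.sort (· ≤ ·)).getD (j - 1) 0 else n

lemma sElt_of_gt (n : ℕ) (S : Finset ℕ) (j : ℕ) (h : S.card < j) : sElt n S j = n := by
  unfold sElt
  rw [if_neg (by omega), if_neg (by omega)]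

/-! ### Standard Young tableaux -/

/-- A standard Young tableau of shape `μ`: a filling of the cells of `μ` by the numbers
`1,…,μ.card`, each used once, strictly increasing along rows and columns
(the entry of a non-cell is `0`). -/
structure SYT (μ : YoungDiagram) where
  entry : ℕ → ℕ → ℕ
  entry_eq_zero : ∀ i j, (i, j) ∉ μ → entry i j = 0
  row_strict : ∀ i j1 j2, j1 < j2 → (i, j2) ∈ μ → entry i j1 < entry i j2
  col_strict : ∀ i1 i2 j, i1 < i2 → (i2, j) ∈ μ → entry i1 j < entry i2 j
  bijOn : Set.BijOn (fun p : ℕ × ℕ => entry p.1 p.2) ↑μ.cells ↑(Finset.Icc 1 μ.card)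

/-- The descent set of a standard Young tableau: those `k` such that `k+1` lies in a
strictly lower row than `k`. -/
def SYT.des {μ : YoungDiagram} (Q : SYT μ) : Finset ℕ :=
  (Finset.Icc 1 (μ.card - 1)).filter fun k =>
    ∃ p1 ∈ μ.cells, ∃ p2 ∈ μ.cells,
      Q.entry p1.1 p1.2 = k ∧ Q.entry p2.1 p2.2 = k + 1 ∧ p1.1 < p2.1

/-- `fSYTRow μ t` is the number of standard Young tableaux of shape `μ` whose first row
contains the numbers `1,…,t`. -/
def fSYTRow (μ : YoungDiagram) (t : ℕ) : ℕ :=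
  Nat.card {Q : SYT μ // ∀ k, 1 ≤ k → k ≤ t → ∃ j, (0, j) ∈ μ ∧ Q.entry 0 j = k}

/-! ### Irreducible characters of the symmetric group, via Jacobi–Trudi -/

/-- The number of functions `f : Fin n → Fin k` which are invariant under `g` and whose
fiber over `i` has `c i` elements.  For `c` a composition of `n`, the function
`g ↦ fixedYoungFns n k c g` is the character of the permutation representation of `𝔖_n`
on ordered set partitions of `{1,…,n}` of type `c`, i.e. of the representation induced
from the trivial representation of the corresponding Young subgroup. -/
def fixedYoungFns (n k : ℕ) (c : Fin k → ℤ) (g : Equiv.Perm (Fin n)) : ℕ :=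
  Nat.card {f : Fin n → Fin k //
    (∀ x, f (g x) = f x) ∧ ∀ i, ((Nat.card {x : Fin n // f x = i} : ℕ) : ℤ) = c i}

/-- The irreducible character `χ^μ` of `𝔖_n` associated to a partition `μ` of `n`
(encoded as a Young diagram with `n` cells), defined through the Jacobi–Trudi
determinantal formula `χ^μ = det (h_{μ_i - i + j})`. -/
def chi (n : ℕ) (μ : YoungDiagram) (g : Equiv.Perm (Fin n)) : ℤ :=
  ∑ σ : Equiv.Perm (Fin μ.rowLens.length),
    ((Equiv.Perm.sign σ : ℤˣ) : ℤ) *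
      (fixedYoungFns n μ.rowLens.length
        (fun i => ((μ.rowLen (i : ℕ) : ℕ) : ℤ) - ((i : ℕ) : ℤ) + ((σ i : ℕ) : ℤ)) g : ℤ)

/-! ### Posets, rank selection, maximal chains and characters -/

/-- The maximal chains of the subposet induced on a subset `A` of a poset. -/
def maxChainsIn {P : Type*} [Preorder P] (A : Set P) : Set (Set P) :=
  {C | C ⊆ A ∧ IsChain (· ≤ ·) C ∧
    ∀ D : Set P, D ⊆ A → IsChain (· ≤ ·) D → C ⊆ D → C = D}

/-- The rank-selected subposet `P_S = {x ∈ P : rk x ∈ S} ∪ {⊥, ⊤}`. -/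
def rankSel {P : Type*} [Preorder P] [OrderBot P] [OrderTop P] (rk : P → ℕ)
    (S : Finset ℕ) : Set P :=
  {x | rk x ∈ S} ∪ {⊥, ⊤}

/-- `a_P(S)`: the number of maximal chains of the rank-selected subposet `P_S`. -/
def chainCount {P : Type*} [Preorder P] [OrderBot P] [OrderTop P] (rk : P → ℕ)
    (S : Finset ℕ) : ℕ :=
  Set.ncard (maxChainsIn (rankSel rk S))

/-- `b_P(S) = Σ_{T ⊆ S} (-1)^{|S-T|} a_P(T)`. -/
def bDim {P : Type*} [Preorder P] [OrderBot P] [OrderTop P] (rk : P → ℕ)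
    (S : Finset ℕ) : ℤ :=
  ∑ T ∈ S.powerset, (-1 : ℤ) ^ (S.card - T.card) * (chainCount rk T : ℤ)

/-- The character of the permutation representation `α_P(S)` of a group `G` acting (via
`act`) on the maximal chains of the rank-selected subposet `P_S`: its value at `g` is
the number of maximal chains of `P_S` fixed by `g`. -/
def gAlpha {P G : Type*} [Preorder P] [OrderBot P] [OrderTop P] (rk : P → ℕ)
    (act : G → P → P) (S : Finset ℕ) (g : G) : ℤ :=
  (Set.ncard {C : Set P | C ∈ maxChainsIn (rankSel rk S) ∧ act g '' C = C} : ℤ)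

/-- The character of the virtual representation
`β_P(S) = Σ_{T ⊆ S} (-1)^{|S-T|} α_P(T)`. -/
def gBeta {P G : Type*} [Preorder P] [OrderBot P] [OrderTop P] (rk : P → ℕ)
    (act : G → P → P) (S : Finset ℕ) (g : G) : ℤ :=
  ∑ T ∈ S.powerset, (-1 : ℤ) ^ (S.card - T.card) * gAlpha rk act T g

/-! ### The poset of injective words -/

/-- An injective word over the alphabet `{1,…,n}`. -/
def InjWord (n : ℕ) : Type := {l : List (Fin n) // l.Nodup}

instance (n : ℕ) : PartialOrder (InjWord n) where
  le u v := u.1.Sublist v.1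
  le_refl u := List.Sublist.refl _
  le_trans u v w h1 h2 := List.Sublist.trans h1 h2
  le_antisymm u v h1 h2 := Subtype.ext (List.Sublist.antisymm h1 h2)

instance (n : ℕ) : OrderBot (InjWord n) where
  bot := ⟨[], List.nodup_nil⟩
  bot_le u := List.nil_sublist u.1

/-- The rank function of the poset of injective words (with a maximum adjoined):
the rank of a word is its length, and the rank of `⊤` is `n+1`. -/
def rkInj (n : ℕ) (x : WithTop (InjWord n)) : ℕ :=
  WithTop.recTopCoe (n + 1) (fun u => u.1.length) x

/-- The action of `𝔖_n` on injective words, letter by letter. -/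
def permWord {n : ℕ} (w : Equiv.Perm (Fin n)) (u : InjWord n) : InjWord n :=
  ⟨u.1.map w, u.2.map w.injective⟩

/-- The character of `α_{P_n}(S)` for the `𝔖_n`-action on the poset of injective words. -/
def injAlpha (n : ℕ) (S : Finset ℕ) (g : Equiv.Perm (Fin n)) : ℤ :=
  gAlpha (rkInj n) (fun w : Equiv.Perm (Fin n) => WithTop.map (permWord w)) S g

/-- The character of `β_{P_n}(S)` for the `𝔖_n`-action on the poset of injective words. -/
def injBeta (n : ℕ) (S : Finset ℕ) (g : Equiv.Perm (Fin n)) : ℤ :=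
  gBeta (rkInj n) (fun w : Equiv.Perm (Fin n) => WithTop.map (permWord w)) S g

/-! ### The poset of r-colored injective words -/

/-- An `r`-colored injective word over `{1,…,n}`: a word in the alphabet
`{1,…,n} × ℤ_r` whose letters have pairwise distinct first coordinates. -/
def CInjWord (n r : ℕ) : Type := {l : List (Fin n × ZMod r) // (l.map Prod.fst).Nodup}

instance (n r : ℕ) : PartialOrder (CInjWord n r) where
  le u v := u.1.Sublist v.1
  le_refl u := List.Sublist.refl _
  le_trans u v w h1 h2 := List.Sublist.trans h1 h2
  le_antisymm u v h1 h2 := Subtype.ext (List.Sublist.antisymm h1 h2)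

instance (n r : ℕ) : OrderBot (CInjWord n r) where
  bot := ⟨[], by simp⟩
  bot_le u := List.nil_sublist u.1

/-- The rank function of the poset `P_{n,r}` of `r`-colored injective words
(with a maximum adjoined). -/
def rkC (n r : ℕ) (x : WithTop (CInjWord n r)) : ℕ :=
  WithTop.recTopCoe (n + 1) (fun u => u.1.length) x

/-- The action of `𝔖_n` on `r`-colored injective words: act on the first coordinate
of each letter, leaving colors unchanged. -/
def permCWord {n r : ℕ} (w : Equiv.Perm (Fin n)) (u : CInjWord n r) : CInjWord n r :=
  ⟨u.1.map (fun p => (w p.1, p.2)), by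
    have h := u.2.map w.injective
    rw [List.map_map] at h ⊢
    exact h⟩

/-- The character of `α_{P_{n,r}}(S)`. -/
def cAlpha (n r : ℕ) (S : Finset ℕ) (g : Equiv.Perm (Fin n)) : ℤ :=
  gAlpha (rkC n r) (fun w : Equiv.Perm (Fin n) => WithTop.map (permCWord w)) S g

/-- The character of `β_{P_{n,r}}(S)`. -/
def cBeta (n r : ℕ) (S : Finset ℕ) (g : Equiv.Perm (Fin n)) : ℤ :=
  gBeta (rkC n r) (fun w : Equiv.Perm (Fin n) => WithTop.map (permCWord w)) S g

/-- `b_{P_{n,r}}(S)`, the dimension of `β_{P_{n,r}}(S)`. -/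
def cChainDim (n r : ℕ) (S : Finset ℕ) : ℤ := bDim (rkC n r) S

/-! ### The statistics τ -/

/-- `τ(w,Q)` for a permutation `w` with descent set `S = {s_1 < ⋯ < s_k}` and a standard
Young tableau `Q`: the largest `i ∈ {0,…,k+1}` such that (a) `w(x) = w_S(x)` for
`x > s_{k+1-i}` and (b) no descent of `Q` is smaller than `n - s_{k+1-i}`. -/
def tau (n : ℕ) (S : Finset ℕ) (wS w : Equiv.Perm (Fin n)) {μ : YoungDiagram}
    (Q : SYT μ) : ℕ :=
  ((Finset.range (S.card + 2)).filter
    (fun i => (∀ x, sElt n S (S.card + 1 - i) < x → x ≤ n → permApp w x = permApp wS x) ∧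
      (∀ d ∈ Q.des, n - sElt n S (S.card + 1 - i) ≤ d))).max'
    ⟨0, by
      have hs := sElt_of_gt n S (S.card + 1 - 0) (by omega)
      refine Finset.mem_filter.2 ⟨Finset.mem_range.2 (by omega), ?_, ?_⟩
      · intro x hx hx'
        rw [hs] at hx
        exact absurd hx (not_lt.2 hx')
      · intro d _
        rw [hs]
        omega⟩

/-- The condition that all the numbers `1,…,t` appear in the first row of the `r`-colored
standard Young tableau `(Q, c)` and are colored with the zero color (the color of the
entry `k` being `c (k-1)`). -/
def zeroFirstRow {μ : YoungDiagram} {r : ℕ} (Q : SYT μ) (c : Fin μ.card → ZMod r)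
    (t : ℕ) : Prop :=
  ∀ k : Fin μ.card, (k : ℕ) < t →
    ((∃ j, (0, j) ∈ μ ∧ Q.entry 0 j = (k : ℕ) + 1) ∧ c k = 0)

/-- `τ(w,Q)` for an `r`-colored standard Young tableau `(Q,c)`. -/
def ctau (n : ℕ) {r : ℕ} (S : Finset ℕ) (wS w : Equiv.Perm (Fin n)) {μ : YoungDiagram}
    (Q : SYT μ) (c : Fin μ.card → ZMod r) : ℕ :=
  ((Finset.range (S.card + 2)).filter
    (fun i => (∀ x, sElt n S (S.card + 1 - i) < x → x ≤ n → permApp w x = permApp wS x) ∧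
      zeroFirstRow Q c (n - sElt n S (S.card + 1 - i)))).max'
    ⟨0, by
      have hs := sElt_of_gt n S (S.card + 1 - 0) (by omega)
      refine Finset.mem_filter.2 ⟨Finset.mem_range.2 (by omega), ?_, ?_⟩
      · intro x hx hx'
        rw [hs] at hx
        exact absurd hx (not_lt.2 hx')
      · rw [hs]
        intro k hk
        exact absurd hk (by omega)⟩

/-- The largest `i ∈ {0,…,n}` such that all the numbers `1,…,i` appear in the first row
of the `r`-colored standard Young tableau `(Q,c)` and are colored with the zero color. -/
def mQ (n : ℕ) {r : ℕ} {μ : YoungDiagram} (Q : SYT μ) (c : Fin μ.card → ZMod r) : ℕ :=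
  ((Finset.range (n + 1)).filter (fun i => zeroFirstRow Q c i)).max'
    ⟨0, Finset.mem_filter.2 ⟨Finset.mem_range.2 (by omega),
      fun k hk => absurd hk (by omega)⟩⟩

/-- The condition, for an `r`-colored permutation `(π, c)` (the color of the entry
`π(x)` in one-line notation being `c (x-1)`), that the entries `π(1),…,π(t)` are in
increasing order and all colored with the zero color. -/
def zeroIncreasing {n r : ℕ} (π : Equiv.Perm (Fin n)) (c : Fin n → ZMod r) (t : ℕ) : Prop :=
  (∀ x y, 1 ≤ x → x < y → y ≤ t → permApp π x < permApp π y) ∧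
  ∀ k : Fin n, (k : ℕ) < t → c k = 0

/-- `τ(w,u)` for an `r`-colored permutation `u = (π, c)`. -/
def tauU (n : ℕ) {r : ℕ} (S : Finset ℕ) (wS w : Equiv.Perm (Fin n))
    (π : Equiv.Perm (Fin n)) (c : Fin n → ZMod r) : ℕ :=
  ((Finset.range (S.card + 2)).filter
    (fun i => (∀ x, sElt n S (S.card + 1 - i) < x → x ≤ n → permApp w x = permApp wS x) ∧
      zeroIncreasing π c (n - sElt n S (S.card + 1 - i)))).max'
    ⟨0, by
      have hs := sElt_of_gt n S (S.card + 1 - 0) (by omega)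
      refine Finset.mem_filter.2 ⟨Finset.mem_range.2 (by omega), ?_, ?_, ?_⟩
      · intro x hx hx'
        rw [hs] at hx
        exact absurd hx (not_lt.2 hx')
      · intro x y hx hxy hy
        rw [hs] at hy
        exact absurd hy (by omega)
      · rw [hs]
        intro k hk
        exact absurd hk (by omega)⟩

/-- The largest `i ∈ {0,…,n}` such that the entries `π(1),…,π(i)` of the `r`-colored
permutation `(π,c)` are in increasing order and all colored with the zero color. -/
def mU (n : ℕ) {r : ℕ} (π : Equiv.Perm (Fin n)) (c : Fin n → ZMod r) : ℕ :=
  ((Finset.range (n + 1)).filter (fun i => zeroIncreasing π c i)).max'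
    ⟨0, Finset.mem_filter.2 ⟨Finset.mem_range.2 (by omega),
      fun x y hx hxy hy => absurd hy (by omega),
      fun k hk => absurd hk (by omega)⟩⟩

/-- `a_m(T)`: the number of chains in the Boolean lattice `B_m` whose elements have
set of ranks (cardinalities) equal to `T`. -/
def boolChains (m : ℕ) (T : Finset ℕ) : ℕ :=
  Nat.card {c : Finset (Finset (Fin m)) //
    IsChain (· ⊆ ·) (↑c : Set (Finset (Fin m))) ∧ c.image Finset.card = T}

end


/-! ## Words with bounded content and alternating sums -/

section PartA

noncomputable def cont {m k : ℕ} (v : Fin m → Fin k) (i : Fin k) : ℤ :=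
  ∑ j, if v j = i then 1 else 0

noncomputable def Wc (k m : ℕ) (c : Fin k → ℤ) : ℤ :=
  ∑ v : Fin m → Fin k, if (∀ i, cont v i ≤ c i) then 1 else 0

noncomputable def Dk (k m : ℕ) (a : Fin k → ℤ) : ℤ :=
  ∑ σ : Equiv.Perm (Fin k), ((Equiv.Perm.sign σ : ℤˣ) : ℤ) *
    Wc k m (fun i => a i + ((σ i : ℕ) : ℤ))

lemma cont_nonneg {m k : ℕ} (v : Fin m → Fin k) (i : Fin k) : 0 ≤ cont v i :=
  Finset.sum_nonneg fun j _ => by split_ifs <;> norm_num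

lemma cont_cons {m k : ℕ} (x : Fin k) (v : Fin m → Fin k) (i : Fin k) :
    cont (Fin.cons x v : Fin (m+1) → Fin k) i = (Pi.single x 1 : Fin k → ℤ) i + cont v i := by
  unfold cont
  rw [Fin.sum_univ_succ]
  simp only [Fin.cons_zero, Fin.cons_succ, Pi.single_apply]
  congr 1
  simp only [eq_comm]

lemma Wc_zero (k : ℕ) (c : Fin k → ℤ) : Wc k 0 c = if ∀ i, 0 ≤ c i then 1 else 0 := by
  unfold Wc cont
  simp

lemma Wc_succ (k m : ℕ) (c : Fin k → ℤ) :
    Wc k (m+1) c = ∑ i, Wc k m (c - Pi.single i 1) := by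
  unfold Wc
  rw [← Fintype.sum_equiv (Fin.consEquiv (fun _ => Fin k))
    (fun p : Fin k × (Fin m → Fin k) => if ∀ i, cont (Fin.cons p.1 p.2 : Fin (m+1) → Fin k) i ≤ c i
      then (1:ℤ) else 0) _ (fun p => rfl), Fintype.sum_prod_type]
  refine Finset.sum_congr rfl fun x _ => Finset.sum_congr rfl fun v _ => ?_
  refine if_congr (forall_congr' fun i => ?_) rfl rfl
  rw [cont_cons, Pi.sub_apply]
  constructor <;> intro h <;> linarith

lemma Wc_neg (k m : ℕ) (c : Fin k → ℤ) (i : Fin k) (h : c i < 0) : Wc k m c = 0 := by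
  unfold Wc
  refine Finset.sum_eq_zero fun v _ => if_neg fun hh => ?_
  have := cont_nonneg v i
  have := hh i
  linarith

lemma cont_comp {m k : ℕ} (v : Fin m → Fin k) (π : Equiv.Perm (Fin k)) (i : Fin k) :
    cont (π ∘ v) (π i) = cont v i := by
  unfold cont
  simp

lemma Wc_perm (k m : ℕ) (c : Fin k → ℤ) (π : Equiv.Perm (Fin k)) :
    Wc k m (c ∘ π) = Wc k m c := by
  unfold Wc
  refine Fintype.sum_equiv (Equiv.arrowCongr (Equiv.refl _) π) _ _ fun v => ?_
  refine if_congr ?_ rfl rfl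
  have : (Equiv.arrowCongr (Equiv.refl (Fin m)) π) v = π ∘ v := by ext; simp
  rw [this]
  constructor
  · intro h i
    have := h (π.symm i)
    rw [← cont_comp v π] at this
    simpa using this
  · intro h i
    rw [← cont_comp v π]
    exact h (π i)

lemma Dk_succ (k m : ℕ) (a : Fin k → ℤ) :
    Dk k (m+1) a = ∑ i, Dk k m (a - Pi.single i 1) := by
  unfold Dk
  rw [Finset.sum_comm]
  refine Finset.sum_congr rfl fun σ _ => ?_
  rw [Wc_succ, Finset.mul_sum]
  refine Finset.sum_congr rfl fun i _ => ?_
  congr 2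
  ext j
  simp only [Pi.sub_apply]
  ring

lemma Dk_perm (k m : ℕ) (a : Fin k → ℤ) (π : Equiv.Perm (Fin k)) :
    Dk k m (a ∘ π) = ((Equiv.Perm.sign π : ℤˣ) : ℤ) * Dk k m a := by
  unfold Dk
  rw [Finset.mul_sum]
  refine Fintype.sum_equiv (Equiv.mulRight π⁻¹) _ _ fun σ => ?_
  have h1 : (fun i => (a ∘ π) i + ((σ i : ℕ) : ℤ))
      = (fun i => a i + ((((Equiv.mulRight π⁻¹) σ) i : ℕ) : ℤ)) ∘ π := by
    ext i; simp
  rw [h1, Wc_perm, ← mul_assoc]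
  congr 1
  simp only [Equiv.coe_mulRight, Equiv.Perm.sign_mul, Equiv.Perm.sign_inv, Units.val_mul]
  rw [mul_comm (((Equiv.Perm.sign σ : ℤˣ) : ℤ)), ← mul_assoc]
  simp [← Units.val_mul]

lemma Dk_eq_zero_of_eq (k m : ℕ) (a : Fin k → ℤ) (i j : Fin k) (hij : i ≠ j) (h : a i = a j) :
    Dk k m a = 0 := by
  have h1 := Dk_perm k m a (Equiv.swap i j)
  have h2 : a ∘ (Equiv.swap i j) = a := by
    ext x
    simp only [Function.comp]
    rcases eq_or_ne x i with rfl | hx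
    · rw [Equiv.swap_apply_left, h]
    rcases eq_or_ne x j with rfl | hx'
    · rw [Equiv.swap_apply_right, h]
    rw [Equiv.swap_apply_of_ne_of_ne hx hx']
  rw [h2, Equiv.Perm.sign_swap hij] at h1
  simp at h1
  omega

lemma Dk_eq_zero_of_neg (k m : ℕ) (a : Fin k → ℤ) (i : Fin k) (h : a i + (k - 1) < 0) :
    Dk k m a = 0 := by
  unfold Dk
  refine Finset.sum_eq_zero fun σ _ => ?_
  rw [Wc_neg k m _ i, mul_zero]
  have := (σ i).2
  omega

/-- The base case: `D` for a diagram. -/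
lemma Dk_zero_one (k : ℕ) (r : ℕ → ℕ) (hr : ∀ i, 1 ≤ i → r i = 0) :
    Dk k 0 (fun i : Fin k => (r i : ℤ) - (i : ℕ)) = 1 := by
  unfold Dk
  rw [Finset.sum_eq_single 1]
  · rw [Wc_zero, if_pos]
    · simp
    · intro i; simp
  · intro σ _ hσ
    rw [Wc_zero, if_neg, mul_zero]
    intro hh
    apply hσ
    have hle : ∀ i : Fin k, i ≤ σ i := by
      intro i
      by_cases hi : 1 ≤ (i : ℕ)
      · have := hh i
        beta_reduce at this
        rw [hr _ hi] at this
        rw [Fin.le_def]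
        omega
      · rw [Fin.le_def]; omega
    have : ∑ i, ((σ i : ℕ)) = ∑ i : Fin k, (i : ℕ) := Equiv.sum_comp σ (fun i : Fin k => (i : ℕ))
    have h3 := (Finset.sum_eq_sum_iff_of_le (f := fun i : Fin k => (i : ℕ))
      (g := fun i : Fin k => (σ i : ℕ)) (s := Finset.univ) (fun i _ => hle i)).1 this.symm
    ext i
    exact (h3 i (Finset.mem_univ _)).symm
  · simp

lemma Dk_zero_two (k : ℕ) (hk : 2 ≤ k) (r : ℕ → ℕ) (h0 : 1 ≤ r 0) (h1 : 1 ≤ r 1) :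
    Dk k 0 (fun i : Fin k => (r i : ℤ) - (i : ℕ)) = 0 := by
  set i0 : Fin k := ⟨0, by omega⟩
  set i1 : Fin k := ⟨1, by omega⟩
  have hne : i0 ≠ i1 := by simp [i0, i1]
  -- replace the entries in rows 0,1 by 0
  set a : Fin k → ℤ := fun i : Fin k => (r i : ℤ) - (i : ℕ)
  have : Dk k 0 a = Dk k 0 (fun i => if i = i0 ∨ i = i1 then 0 else a i) := by
    unfold Dk
    refine Finset.sum_congr rfl fun σ _ => ?_
    congr 1
    rw [Wc_zero, Wc_zero]
    refine if_congr (forall_congr' fun i => ?_) rfl rfl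
    beta_reduce
    by_cases hi : i = i0 ∨ i = i1
    · rw [if_pos hi]
      rcases hi with rfl | rfl
      · simp only [a, i0]; omega
      · simp only [a, i1]; push_cast; omega
    · rw [if_neg hi]
  rw [this]
  refine Dk_eq_zero_of_eq k 0 _ i0 i1 hne ?_
  simp

end PartA


/-! ## Standard Young tableaux: removing the largest entry -/

section PartS

lemma SYT.ext' {μ : YoungDiagram} {Q R : SYT μ} (h : ∀ i j, Q.entry i j = R.entry i j) : Q = R := by
  cases Q with | mk e1 _ _ _ _ => cases R with | mk e2 _ _ _ _ =>
  have : e1 = e2 := by funext i j; exact h i j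
  subst this; rfl

lemma SYT.mem_Icc {μ : YoungDiagram} (Q : SYT μ) {i j : ℕ} (h : (i, j) ∈ μ) :
    1 ≤ Q.entry i j ∧ Q.entry i j ≤ μ.card := by
  have := Q.bijOn.mapsTo (show (i, j) ∈ (↑μ.cells : Set (ℕ × ℕ)) from h)
  simpa using this

lemma SYT.le_card {μ : YoungDiagram} (Q : SYT μ) (i j : ℕ) : Q.entry i j ≤ μ.card := by
  by_cases h : (i, j) ∈ μ
  · exact (Q.mem_Icc h).2
  · rw [Q.entry_eq_zero i j h]; omega

lemma SYT.inj {μ : YoungDiagram} (Q : SYT μ) {p q : ℕ × ℕ} (hp : p ∈ μ) (hq : q ∈ μ)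
    (h : Q.entry p.1 p.2 = Q.entry q.1 q.2) : p = q :=
  Q.bijOn.injOn (show p ∈ (↑μ.cells : Set (ℕ × ℕ)) from hp)
    (show q ∈ (↑μ.cells : Set (ℕ × ℕ)) from hq) h

lemma SYT.surj {μ : YoungDiagram} (Q : SYT μ) {d : ℕ} (h1 : 1 ≤ d) (h2 : d ≤ μ.card) :
    ∃ p : ℕ × ℕ, p ∈ μ ∧ Q.entry p.1 p.2 = d := by
  obtain ⟨p, hp, h⟩ := Q.bijOn.surjOn (show d ∈ (↑(Finset.Icc 1 μ.card) : Set ℕ) by simp [h1, h2])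
  exact ⟨p, hp, h⟩

lemma SYT.mem_des {μ : YoungDiagram} (Q : SYT μ) {d : ℕ} : d ∈ Q.des ↔
    (1 ≤ d ∧ d ≤ μ.card - 1) ∧ ∃ p1 ∈ μ, ∃ p2 ∈ μ,
      Q.entry p1.1 p1.2 = d ∧ Q.entry p2.1 p2.2 = d + 1 ∧ p1.1 < p2.1 := by
  unfold SYT.des
  rw [Finset.mem_filter, Finset.mem_Icc]
  rfl

instance (μ : YoungDiagram) : Finite (SYT μ) := by
  refine Finite.of_injective (β := μ.cells → Fin (μ.card + 1))
    (fun Q p => ⟨Q.entry p.1.1 p.1.2, by have := Q.le_card p.1.1 p.1.2; omega⟩) ?_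
  intro Q R h
  refine SYT.ext' fun i j => ?_
  by_cases hij : (i, j) ∈ μ
  · have := congrFun h ⟨(i, j), hij⟩
    simpa using this
  · rw [Q.entry_eq_zero i j hij, R.entry_eq_zero i j hij]

noncomputable instance (μ : YoungDiagram) : Fintype (SYT μ) := Fintype.ofFinite _

/-- the descent condition -/
def desOK {μ : YoungDiagram} (m : ℕ) (Q : SYT μ) : Prop := ∀ d ∈ Q.des, μ.card ≤ d + m

noncomputable def fS (μ : YoungDiagram) (m : ℕ) : ℤ :=
  ∑ Q : SYT μ, if desOK m Q then 1 else 0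

def rmCorner (μ : YoungDiagram) (i : ℕ) (h : μ.rowLen (i+1) < μ.rowLen i) : YoungDiagram where
  cells := μ.cells.erase (i, μ.rowLen i - 1)
  isLowerSet := by
    rintro ⟨a, b⟩ ⟨a', b'⟩ hab hm
    simp only [Finset.coe_erase, Set.mem_sdiff, Set.mem_singleton_iff, Finset.mem_coe] at hm ⊢
    have hle : a' ≤ a ∧ b' ≤ b := hab
    have h1 : (a, b) ∈ μ := hm.1
    refine ⟨μ.isLowerSet hab hm.1, ?_⟩
    intro heq
    rw [Prod.mk.injEq] at heq
    obtain ⟨rfl, rfl⟩ := heq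
    rw [YoungDiagram.mem_iff_lt_rowLen] at h1
    by_cases ha : a = a'
    · subst ha
      apply hm.2
      rw [Prod.mk.injEq]
      exact ⟨rfl, by omega⟩
    · have := μ.rowLen_anti (a'+1) a (by omega)
      omega

lemma mem_rmCorner {μ : YoungDiagram} {i : ℕ} {h : μ.rowLen (i+1) < μ.rowLen i} {p : ℕ × ℕ} :
    p ∈ rmCorner μ i h ↔ p ≠ (i, μ.rowLen i - 1) ∧ p ∈ μ := by
  change p ∈ μ.cells.erase _ ↔ _
  rw [Finset.mem_erase]; rfl

lemma corner_mem {μ : YoungDiagram} {i : ℕ} (h : μ.rowLen (i+1) < μ.rowLen i) :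
    (i, μ.rowLen i - 1) ∈ μ := by
  rw [YoungDiagram.mem_iff_lt_rowLen]; omega

lemma card_rmCorner {μ : YoungDiagram} {i : ℕ} (h : μ.rowLen (i+1) < μ.rowLen i) :
    (rmCorner μ i h).card + 1 = μ.card := by
  have : (i, μ.rowLen i - 1) ∈ μ.cells := corner_mem h
  exact Finset.card_erase_add_one this

lemma rowLen_rmCorner {μ : YoungDiagram} {i : ℕ} (h : μ.rowLen (i+1) < μ.rowLen i) (x : ℕ) :
    (rmCorner μ i h).rowLen x = if x = i then μ.rowLen i - 1 else μ.rowLen x := by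
  have key : ∀ y, y < (rmCorner μ i h).rowLen x ↔
      y < if x = i then μ.rowLen i - 1 else μ.rowLen x := by
    intro y
    rw [← YoungDiagram.mem_iff_lt_rowLen, mem_rmCorner, YoungDiagram.mem_iff_lt_rowLen]
    by_cases hx : x = i
    · subst hx
      simp only [if_true, ne_eq, Prod.mk.injEq, true_and]; omega
    · simp [hx]
  have h1 := key ((rmCorner μ i h).rowLen x)
  have h2 := key (if x = i then μ.rowLen i - 1 else μ.rowLen x)
  omega

def rmSYT {μ : YoungDiagram} {i : ℕ} (h : μ.rowLen (i+1) < μ.rowLen i) (Q : SYT μ)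
    (hQ : Q.entry i (μ.rowLen i - 1) = μ.card) : SYT (rmCorner μ i h) where
  entry x y := if (x, y) = (i, μ.rowLen i - 1) then 0 else Q.entry x y
  entry_eq_zero x y hxy := by
    split_ifs with hc
    · rfl
    · rw [mem_rmCorner, not_and] at hxy
      exact Q.entry_eq_zero x y (hxy hc)
  row_strict x j1 j2 hj hm := by
    rw [mem_rmCorner] at hm
    have hm2 := hm.2
    rw [YoungDiagram.mem_iff_lt_rowLen] at hm2
    rw [if_neg, if_neg hm.1]
    · exact Q.row_strict x j1 j2 hj hm.2
    · rw [Prod.mk.injEq]; rintro ⟨rfl, rfl⟩; omega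
  col_strict x1 x2 j hx hm := by
    rw [mem_rmCorner] at hm
    have hm2 := hm.2
    rw [YoungDiagram.mem_iff_lt_rowLen] at hm2
    rw [if_neg, if_neg hm.1]
    · exact Q.col_strict x1 x2 j hx hm.2
    · rw [Prod.mk.injEq]; rintro ⟨rfl, rfl⟩
      have := μ.rowLen_anti (x1+1) x2 (by omega)
      omega
  bijOn := by
    have hcard := card_rmCorner h
    refine ⟨?_, ?_, ?_⟩
    · rintro ⟨x, y⟩ hp
      have hp' := mem_rmCorner.1 (show (x, y) ∈ rmCorner μ i h from hp)
      beta_reduce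
      rw [if_neg hp'.1]
      have h1 := Q.mem_Icc hp'.2
      have h2 : Q.entry x y ≠ μ.card := fun he =>
        hp'.1 (Q.inj hp'.2 (corner_mem h) (he.trans hQ.symm))
      simp only [Finset.coe_Icc, Set.mem_Icc]
      omega
    · rintro ⟨x, y⟩ hp ⟨x', y'⟩ hq heq
      have hp' := mem_rmCorner.1 (show (x, y) ∈ rmCorner μ i h from hp)
      have hq' := mem_rmCorner.1 (show (x', y') ∈ rmCorner μ i h from hq)
      beta_reduce at heq
      rw [if_neg hp'.1, if_neg hq'.1] at heq
      exact Q.inj hp'.2 hq'.2 heq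
    · intro d hd
      simp only [Finset.coe_Icc, Set.mem_Icc] at hd
      obtain ⟨⟨x, y⟩, hp, he⟩ := Q.surj hd.1 (by omega)
      have hne : (x, y) ≠ (i, μ.rowLen i - 1) := by
        rw [Ne, Prod.mk.injEq]; rintro ⟨rfl, rfl⟩
        simp only at he
        omega
      refine ⟨(x, y), ?_, ?_⟩
      · exact (mem_rmCorner.2 ⟨hne, hp⟩ : (x, y) ∈ rmCorner μ i h)
      · beta_reduce
        rw [if_neg hne]; exact he

def addSYT {μ : YoungDiagram} {i : ℕ} (h : μ.rowLen (i+1) < μ.rowLen i)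
    (Q : SYT (rmCorner μ i h)) : SYT μ where
  entry x y := if (x, y) = (i, μ.rowLen i - 1) then μ.card else Q.entry x y
  entry_eq_zero x y hxy := by
    rw [if_neg]
    · exact Q.entry_eq_zero x y fun hm => hxy (mem_rmCorner.1 hm).2
    · intro hc; rw [hc] at hxy; exact hxy (corner_mem h)
  row_strict x j1 j2 hj hm := by
    have hcard := card_rmCorner h
    have hm2 := hm
    rw [YoungDiagram.mem_iff_lt_rowLen] at hm2
    rw [if_neg]
    · split_ifs with hc
      · have := Q.le_card x j1; omega
      · exact Q.row_strict x j1 j2 hj (mem_rmCorner.2 ⟨hc, hm⟩)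
    · rw [Prod.mk.injEq]; rintro ⟨rfl, rfl⟩; omega
  col_strict x1 x2 j hx hm := by
    have hcard := card_rmCorner h
    have hm2 := hm
    rw [YoungDiagram.mem_iff_lt_rowLen] at hm2
    rw [if_neg]
    · split_ifs with hc
      · have := Q.le_card x1 j; omega
      · exact Q.col_strict x1 x2 j hx (mem_rmCorner.2 ⟨hc, hm⟩)
    · rw [Prod.mk.injEq]; rintro ⟨rfl, rfl⟩
      have := μ.rowLen_anti (x1+1) x2 (by omega)
      omega
  bijOn := by
    have hcard := card_rmCorner h
    refine ⟨?_, ?_, ?_⟩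
    · rintro ⟨x, y⟩ hp
      beta_reduce
      simp only [Finset.coe_Icc, Set.mem_Icc]
      split_ifs with hc
      · omega
      · have h1 := Q.mem_Icc (mem_rmCorner.2 ⟨hc, hp⟩)
        omega
    · rintro ⟨x, y⟩ hp ⟨x', y'⟩ hq heq
      beta_reduce at heq
      have e1 := Q.le_card x y
      have e2 := Q.le_card x' y'
      split_ifs at heq with hc hc' hc'
      · rw [hc, hc']
      · simp only at heq; omega
      · simp only at heq; omega
      · exact Q.inj (mem_rmCorner.2 ⟨hc, hp⟩) (mem_rmCorner.2 ⟨hc', hq⟩) heq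
    · intro d hd
      simp only [Finset.coe_Icc, Set.mem_Icc] at hd
      by_cases hdc : d = μ.card
      · refine ⟨(i, μ.rowLen i - 1), corner_mem h, ?_⟩
        simp [hdc]
      · obtain ⟨⟨x, y⟩, hp, he⟩ := Q.surj hd.1 (by omega)
        rw [mem_rmCorner] at hp
        refine ⟨(x, y), hp.2, ?_⟩
        beta_reduce
        rw [if_neg hp.1]; exact he

def cornerEquiv {μ : YoungDiagram} {i : ℕ} (h : μ.rowLen (i+1) < μ.rowLen i) :
    {Q : SYT μ // Q.entry i (μ.rowLen i - 1) = μ.card} ≃ SYT (rmCorner μ i h) where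
  toFun Q := rmSYT h Q.1 Q.2
  invFun Q := ⟨addSYT h Q, by simp [addSYT]⟩
  left_inv := by
    rintro ⟨Q, hQ⟩
    refine Subtype.ext (SYT.ext' fun x y => ?_)
    simp only [addSYT, rmSYT]
    split_ifs with hc
    · rw [Prod.mk.injEq] at hc
      rw [hc.1, hc.2, hQ]
    · rfl
  right_inv := by
    intro Q
    refine SYT.ext' fun x y => ?_
    simp only [addSYT, rmSYT]
    split_ifs with hc
    · rw [Q.entry_eq_zero]
      rw [mem_rmCorner]
      exact fun hh => hh.1 hc
    · rfl

lemma desOK_rm {μ : YoungDiagram} {i : ℕ} (h : μ.rowLen (i+1) < μ.rowLen i) (Q : SYT μ)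
    (hQ : Q.entry i (μ.rowLen i - 1) = μ.card) (m : ℕ) :
    desOK (m+1) Q ↔ desOK m (rmSYT h Q hQ) := by
  have hcard := card_rmCorner h
  have hent : ∀ p : ℕ × ℕ, p ≠ (i, μ.rowLen i - 1) → (rmSYT h Q hQ).entry p.1 p.2 = Q.entry p.1 p.2 := by
    intro p hp
    exact if_neg hp
  constructor
  · intro H d hd
    rw [SYT.mem_des] at hd
    obtain ⟨⟨h1, h2⟩, p1, hp1, p2, hp2, e1, e2, h3⟩ := hd
    rw [mem_rmCorner] at hp1 hp2
    rw [hent _ hp1.1] at e1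
    rw [hent _ hp2.1] at e2
    have := H d (Q.mem_des.2 ⟨⟨h1, by omega⟩, p1, hp1.2, p2, hp2.2, e1, e2, h3⟩)
    omega
  · intro H d hd
    rw [SYT.mem_des] at hd
    obtain ⟨⟨h1, h2⟩, p1, hp1, p2, hp2, e1, e2, h3⟩ := hd
    by_cases hdc : d = μ.card - 1
    · omega
    have n1 : p1 ≠ (i, μ.rowLen i - 1) := by
      rintro rfl; simp only at e1; omega
    have n2 : p2 ≠ (i, μ.rowLen i - 1) := by
      rintro rfl; simp only at e2; omega
    have := H d ((SYT.mem_des _).2 ⟨⟨h1, by omega⟩, p1, mem_rmCorner.2 ⟨n1, hp1⟩, p2,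
      mem_rmCorner.2 ⟨n2, hp2⟩, by rw [hent _ n1, e1], by rw [hent _ n2, e2], h3⟩)
    omega

lemma fS_corner {μ : YoungDiagram} {i : ℕ} (h : μ.rowLen (i+1) < μ.rowLen i) (m : ℕ) :
    (∑ Q : SYT μ, if desOK (m+1) Q ∧ Q.entry i (μ.rowLen i - 1) = μ.card then (1:ℤ) else 0)
      = fS (rmCorner μ i h) m := by
  unfold fS
  rw [← Fintype.sum_equiv (cornerEquiv h) (fun Q => if desOK (m+1) Q.1 then (1:ℤ) else 0) _
    (fun Q => if_congr (desOK_rm h Q.1 Q.2 m) rfl rfl)]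
  rw [← Finset.sum_subtype (Finset.univ.filter fun Q : SYT μ =>
    Q.entry i (μ.rowLen i - 1) = μ.card) (by simp) (fun Q => if desOK (m+1) Q then (1:ℤ) else 0),
    Finset.sum_filter]
  refine Finset.sum_congr rfl fun Q _ => ?_
  by_cases h1 : desOK (m+1) Q <;> by_cases h2 : Q.entry i (μ.rowLen i - 1) = μ.card <;> simp [h1, h2]

lemma max_is_corner {μ : YoungDiagram} (hpos : 0 < μ.card) (Q : SYT μ) (i : ℕ)
    (h : Q.entry i (μ.rowLen i - 1) = μ.card) : μ.rowLen (i+1) < μ.rowLen i := by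
  by_contra hcon
  have h1 := μ.rowLen_anti i (i+1) (by omega)
  by_cases h0 : μ.rowLen i = 0
  · rw [Q.entry_eq_zero] at h
    · omega
    · rw [YoungDiagram.mem_iff_lt_rowLen]; omega
  · have := Q.col_strict i (i+1) (μ.rowLen i - 1) (by omega)
      (by rw [YoungDiagram.mem_iff_lt_rowLen]; omega)
    have := Q.le_card (i+1) (μ.rowLen i - 1)
    omega

lemma exists_max_row {μ : YoungDiagram} (hpos : 0 < μ.card) (Q : SYT μ) :
    ∃ i, i < μ.colLen 0 ∧ Q.entry i (μ.rowLen i - 1) = μ.card := by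
  obtain ⟨⟨i, j⟩, hp, he⟩ := Q.surj hpos le_rfl
  have hp' := hp
  rw [YoungDiagram.mem_iff_lt_rowLen] at hp'
  refine ⟨i, ?_, ?_⟩
  · rw [← YoungDiagram.mem_iff_lt_colLen, YoungDiagram.mem_iff_lt_rowLen]; omega
  · have : j = μ.rowLen i - 1 := by
      by_contra hne
      have := Q.row_strict i j (μ.rowLen i - 1) (by omega)
        (by rw [YoungDiagram.mem_iff_lt_rowLen]; omega)
      have := Q.le_card i (μ.rowLen i - 1)
      simp only at he
      omega
    rw [← this]; exact he

lemma max_row_unique {μ : YoungDiagram} (hpos : 0 < μ.card) (Q : SYT μ) (i i' : ℕ)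
    (h : Q.entry i (μ.rowLen i - 1) = μ.card) (h' : Q.entry i' (μ.rowLen i' - 1) = μ.card) :
    i = i' := by
  have c := corner_mem (max_is_corner hpos Q i h)
  have c' := corner_mem (max_is_corner hpos Q i' h')
  have := Q.inj c c' (h.trans h'.symm)
  exact congrArg Prod.fst this

lemma fS_succ {μ : YoungDiagram} (hpos : 0 < μ.card) (k : ℕ) (hk : μ.colLen 0 ≤ k) (m : ℕ) :
    fS μ (m+1) = ∑ i : Fin k, if h : μ.rowLen (i+1) < μ.rowLen i then
      fS (rmCorner μ i h) m else 0 := by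
  have : ∀ Q : SYT μ, (if desOK (m+1) Q then (1:ℤ) else 0) = ∑ i : Fin k,
      if desOK (m+1) Q ∧ Q.entry i (μ.rowLen i - 1) = μ.card then (1:ℤ) else 0 := by
    intro Q
    obtain ⟨i, hi, he⟩ := exists_max_row hpos Q
    rw [Finset.sum_eq_single (⟨i, by omega⟩ : Fin k)]
    · simp [he]
    · intro b _ hb
      rw [if_neg]
      rintro ⟨_, h2⟩
      exact hb (Fin.ext (max_row_unique hpos Q b i h2 he))
    · simp
  conv_lhs => unfold fS
  simp_rw [this]
  rw [Finset.sum_comm]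
  refine Finset.sum_congr rfl fun i _ => ?_
  split_ifs with h
  · exact fS_corner h m
  · refine Finset.sum_eq_zero fun Q _ => if_neg ?_
    rintro ⟨_, h2⟩
    exact h (max_is_corner hpos Q i h2)

end PartS


section PartS2

lemma rowLen_zero_of {μ : YoungDiagram} (h : (1, 0) ∉ μ) (i : ℕ) (hi : 1 ≤ i) : μ.rowLen i = 0 := by
  rw [YoungDiagram.mem_iff_lt_rowLen] at h
  have := μ.rowLen_anti 1 i hi
  omega

lemma card_one_row {μ : YoungDiagram} (h : (1, 0) ∉ μ) : μ.card = μ.rowLen 0 := by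
  rw [YoungDiagram.rowLen_eq_card]
  change μ.cells.card = _
  congr 1
  ext ⟨i, j⟩
  rw [YoungDiagram.mem_row_iff]
  constructor
  · intro hm
    refine ⟨hm, ?_⟩
    by_contra hi
    have hm' : (i, j) ∈ μ := hm
    rw [YoungDiagram.mem_iff_lt_rowLen, rowLen_zero_of h i (by simp only at hi; omega)] at hm'
    omega
  · exact fun hm => hm.1

lemma one_row_mem {μ : YoungDiagram} (h : (1, 0) ∉ μ) (i j : ℕ) :
    (i, j) ∈ μ ↔ i = 0 ∧ j < μ.card := by
  rw [YoungDiagram.mem_iff_lt_rowLen]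
  by_cases hi : i = 0
  · subst hi; rw [card_one_row h]; simp
  · rw [rowLen_zero_of h i (by omega)]; simp [hi]

lemma one_row_entry {μ : YoungDiagram} (h : (1, 0) ∉ μ) (Q : SYT μ) (j : ℕ) (hj : j < μ.card) :
    Q.entry 0 j = j + 1 := by
  have hm : ∀ j, j < μ.card → (0, j) ∈ μ := fun j hj => (one_row_mem h 0 j).2 ⟨rfl, hj⟩
  have lo : ∀ j, j < μ.card → j + 1 ≤ Q.entry 0 j := by
    intro j
    induction j with
    | zero => intro hj; exact (Q.mem_Icc (hm 0 hj)).1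
    | succ j ih =>
      intro hj
      have := ih (by omega)
      have := Q.row_strict 0 j (j+1) (by omega) (hm _ hj)
      omega
  have hi : ∀ d j, j + d + 1 = μ.card → Q.entry 0 j ≤ j + 1 := by
    intro d
    induction d with
    | zero => intro j hj; have := Q.le_card 0 j; omega
    | succ d ih =>
      intro j hj
      have := ih (j+1) (by omega)
      have := Q.row_strict 0 j (j+1) (by omega) (hm _ (by omega))
      omega
  exact le_antisymm (hi (μ.card - 1 - j) j (by omega)) (lo j hj)

def oneRow {μ : YoungDiagram} (h : (1, 0) ∉ μ) : SYT μ where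
  entry i j := if (i, j) ∈ μ then j + 1 else 0
  entry_eq_zero i j hm := if_neg hm
  row_strict i j1 j2 hj hm := by
    have := (one_row_mem h i j2).1 hm
    rw [if_pos hm, if_pos ((one_row_mem h i j1).2 ⟨this.1, by omega⟩)]
    omega
  col_strict i1 i2 j hi hm := by
    have := (one_row_mem h i2 j).1 hm
    omega
  bijOn := by
    refine ⟨?_, ?_, ?_⟩
    · rintro ⟨i, j⟩ hp
      have hp' : (i, j) ∈ μ := hp
      have := (one_row_mem h i j).1 hp'
      beta_reduce
      rw [if_pos hp']
      simp only [Finset.coe_Icc, Set.mem_Icc]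
      omega
    · rintro ⟨i, j⟩ hp ⟨i', j'⟩ hp2 he
      have hp' : (i, j) ∈ μ := hp
      have hp2' : (i', j') ∈ μ := hp2
      have h1 := (one_row_mem h i j).1 hp'
      have h2 := (one_row_mem h i' j').1 hp2'
      beta_reduce at he
      rw [if_pos hp', if_pos hp2'] at he
      rw [Prod.mk.injEq]
      simp only at he
      omega
    · intro d hd
      simp only [Finset.coe_Icc, Set.mem_Icc] at hd
      have : (0, d - 1) ∈ μ := (one_row_mem h 0 (d-1)).2 ⟨rfl, by omega⟩
      refine ⟨(0, d - 1), this, ?_⟩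
      beta_reduce
      rw [if_pos this]
      simp only
      omega

lemma fS_zero_one {μ : YoungDiagram} (h : (1, 0) ∉ μ) : fS μ 0 = 1 := by
  unfold fS
  rw [Finset.sum_eq_single (oneRow h)]
  · rw [if_pos]
    intro d hd
    rw [SYT.mem_des] at hd
    obtain ⟨_, ⟨a, b⟩, hp1, ⟨c, e⟩, hp2, _, _, hlt⟩ := hd
    have h1 := (one_row_mem h _ _).1 hp1
    have h2 := (one_row_mem h _ _).1 hp2
    simp only at hlt
    omega
  · intro Q _ hQ
    exfalso; apply hQ
    refine SYT.ext' fun i j => ?_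
    by_cases hm : (i, j) ∈ μ
    · have h1 := (one_row_mem h _ _).1 hm
      obtain ⟨rfl, hj⟩ := h1
      rw [one_row_entry h _ j hj, one_row_entry h _ j hj]
    · rw [SYT.entry_eq_zero _ _ _ hm, SYT.entry_eq_zero _ _ _ hm]
  · simp

lemma fS_zero_two {μ : YoungDiagram} (h : (1, 0) ∈ μ) : fS μ 0 = 0 := by
  unfold fS
  refine Finset.sum_eq_zero fun Q _ => if_neg fun hQ => ?_
  have key : ∀ d, 1 ≤ d → d ≤ μ.card → ∀ p, p ∈ μ → Q.entry p.1 p.2 = d → p.1 = 0 := by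
    intro d hd
    induction d, hd using Nat.le_induction with
    | base =>
      rintro _ ⟨i, j⟩ hp he
      by_contra hi
      simp only at he hi
      have h1 := Q.col_strict 0 i j (by omega) hp
      have h2 := (Q.mem_Icc (μ.isLowerSet (show (0, j) ≤ (i, j) from ⟨Nat.zero_le _, le_rfl⟩) hp)).1
      omega
    | succ d hd ih =>
      intro hc p hp he
      obtain ⟨q, hq, hqe⟩ := Q.surj hd (by omega)
      have hq0 := ih (by omega) q hq hqe
      by_contra hp0
      have := hQ d (Q.mem_des.2 ⟨⟨hd, by omega⟩, q, hq, p, hp, hqe, he, by omega⟩)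
      omega
  have h1 := Q.mem_Icc h
  have := key _ h1.1 h1.2 (1, 0) h rfl
  simp at this

theorem fS_eq_Dk (k m : ℕ) : ∀ μ : YoungDiagram, μ.colLen 0 ≤ k → m ≤ μ.card →
    fS μ m = Dk k m (fun i : Fin k => (μ.rowLen i : ℤ) - (i : ℕ)) := by
  induction m with
  | zero =>
    intro μ hk _
    by_cases h : (1, 0) ∈ μ
    · have hk2 := YoungDiagram.mem_iff_lt_colLen.1 h
      have h1 := YoungDiagram.mem_iff_lt_rowLen.1 h
      have h2 := μ.rowLen_anti 0 1 (by omega)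
      rw [fS_zero_two h, Dk_zero_two k (by omega) μ.rowLen (by omega) (by omega)]
    · rw [fS_zero_one h, Dk_zero_one k μ.rowLen (rowLen_zero_of h)]
  | succ m ih =>
    intro μ hk hm
    rw [fS_succ (by omega) k hk, Dk_succ]
    refine Finset.sum_congr rfl fun i _ => ?_
    split_ifs with h
    · have hc := card_rmCorner h
      rw [ih _ _ (by omega)]
      · congr 1
        ext j
        rw [rowLen_rmCorner, Pi.sub_apply, Pi.single_apply]
        by_cases hj : j = i
        · subst hj; simp; omega
        · have : (j : ℕ) ≠ i := fun hh => hj (Fin.ext hh)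
          simp [hj, this]
      · by_contra hcon
        have : (k, 0) ∈ rmCorner μ i h := YoungDiagram.mem_iff_lt_colLen.2 (by omega)
        have := YoungDiagram.mem_iff_lt_colLen.1 (mem_rmCorner.1 this).2
        omega
    · have ha := μ.rowLen_anti i (i+1) (by omega)
      by_cases hi : (i : ℕ) + 1 < k
      · rw [Dk_eq_zero_of_eq k m _ i ⟨i+1, hi⟩]
        · intro hh; have := congrArg Fin.val hh; simp at this
        · have : (⟨i+1, hi⟩ : Fin k) ≠ i := by
            intro hh; have := congrArg Fin.val hh; simp at this
          simp only [Pi.sub_apply, Pi.single_apply, this, if_true, if_false]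
          push_cast
          omega
      · have h0 : μ.rowLen (i+1) = 0 := by
          by_contra hne
          have : ((i:ℕ)+1, 0) ∈ μ := YoungDiagram.mem_iff_lt_rowLen.2 (by omega)
          have := YoungDiagram.mem_iff_lt_colLen.1 this
          omega
        rw [Dk_eq_zero_of_neg k m _ i]
        simp only [Pi.sub_apply, Pi.single_apply, if_true]
        omega

end PartS2


section PartB

lemma burnside_aux {G X : Type*} [Group G] [Fintype G] [Fintype X] (act : G → X → X)
    (hmul : ∀ g h x, act (g * h) x = act g (act h x)) (P : X → Prop) (p0 : X)
    (h1 : ∀ p, P p → ∃ g, act g p0 = p) (h2 : ∀ g, P (act g p0))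
    [∀ g p, Decidable (P p ∧ act g p = p)] :
    (∑ g : G, ∑ p : X, if P p ∧ act g p = p then (1:ℤ) else 0) = Fintype.card G := by
  rw [Finset.sum_comm]
  have : ∀ p : X, (∑ g : G, if P p ∧ act g p = p then (1:ℤ) else 0)
      = ∑ g : G, if act g p0 = p then (1:ℤ) else 0 := by
    intro p
    by_cases hp : P p
    · obtain ⟨h, hh⟩ := h1 p hp
      refine Fintype.sum_equiv (Equiv.mulRight h) _ _ fun g => ?_
      simp [hp, hmul, hh]
    · rw [Finset.sum_eq_zero, Finset.sum_eq_zero]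
      · intro g _
        rw [if_neg]
        intro he; apply hp; rw [← he]; exact h2 g
      · intro g _
        rw [if_neg]; exact fun hh => hp hh.1
  simp_rw [this]
  rw [Finset.sum_comm]
  simp

lemma exists_perm_of_fiber {α ι : Type*} [Fintype α] (F F' : α → ι)
    (h : ∀ i, Nat.card {x // F x = i} = Nat.card {x // F' x = i}) :
    ∃ g : Equiv.Perm α, ∀ x, F' (g x) = F x :=
  ⟨Equiv.ofFiberEquiv fun i => Fintype.equivOfCardEq (by rw [← Nat.card_eq_fintype_card, ← Nat.card_eq_fintype_card, h i]), fun x => Equiv.ofFiberEquiv_map _ x⟩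

lemma exists_content {k n : ℕ} (d : Fin k → ℕ) (h : ∑ i, d i = n) :
    ∃ f : Fin n → Fin k, ∀ i, Fintype.card {x // f x = i} = d i := by
  have e : Fin n ≃ Σ i, Fin (d i) := Fintype.equivOfCardEq (by simp [h])
  refine ⟨fun x => (e x).1, fun i => ?_⟩
  have e2 : {x // (e x).1 = i} ≃ Fin (d i) :=
    (e.subtypeEquiv (q := fun s : Σ i, Fin (d i) => s.1 = i) (fun x => Iff.rfl)).trans (Equiv.sigmaSubtype i)
  rw [Fintype.card_congr e2, Fintype.card_fin]

/-- fibre counts as sums -/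
lemma card_eq_sum_ite {α : Type*} [Fintype α] (p : α → Prop) [DecidablePred p]
    [Fintype {x // p x}] :
    (Fintype.card {x // p x} : ℤ) = ∑ x, if p x then (1:ℤ) else 0 := by
  rw [Fintype.card_of_subtype (Finset.univ.filter p) (by simp)]; simp

noncomputable def markF {m n k : ℕ} (u : Fin m ↪ Fin n) (f : Fin n → Fin k) (x : Fin n) :
    Fin m ⊕ Fin k :=
  if h : ∃ j, u j = x then Sum.inl h.choose else Sum.inr (f x)

lemma markF_inl {m n k : ℕ} (u : Fin m ↪ Fin n) (f : Fin n → Fin k) (x : Fin n) (j : Fin m) :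
    markF u f x = Sum.inl j ↔ x = u j := by
  unfold markF
  split_ifs with h
  · rw [Sum.inl.injEq]
    constructor
    · rintro rfl; exact h.choose_spec.symm
    · intro hx; apply u.injective; rw [h.choose_spec, hx]
  · simp only [reduceCtorEq, false_iff]
    intro hx; exact h ⟨j, hx.symm⟩

lemma markF_inr {m n k : ℕ} (u : Fin m ↪ Fin n) (f : Fin n → Fin k) (x : Fin n) (i : Fin k) :
    markF u f x = Sum.inr i ↔ f x = i ∧ ¬ ∃ j, u j = x := by
  unfold markF
  split_ifs with h
  · simp [h]
  · simp [h]

lemma markF_card_inr {m n k : ℕ} (u : Fin m ↪ Fin n) (f : Fin n → Fin k) (i : Fin k) :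
    (Nat.card {x // markF u f x = Sum.inr i} : ℤ)
      = (Nat.card {x // f x = i} : ℤ) - cont (f ∘ u) i := by
  rw [Nat.card_eq_fintype_card, Nat.card_eq_fintype_card, card_eq_sum_ite, card_eq_sum_ite, eq_sub_iff_add_eq]
  have : cont (f ∘ u) i = ∑ x, if f x = i ∧ ∃ j, u j = x then (1:ℤ) else 0 := by
    unfold cont
    rw [← Finset.sum_filter, ← Finset.sum_filter, Finset.sum_const, Finset.sum_const]
    congr 1
    rw [← Finset.card_map u]
    congr 1
    ext x
    simp only [Finset.mem_map, Finset.mem_filter, Finset.mem_univ, true_and, Function.comp]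
    constructor
    · rintro ⟨j, h1, rfl⟩; exact ⟨h1, j, rfl⟩
    · rintro ⟨h1, j, rfl⟩; exact ⟨j, h1, rfl⟩
  rw [this, ← Finset.sum_add_distrib]
  refine Finset.sum_congr rfl fun x _ => ?_
  simp only [markF_inr]
  by_cases h1 : f x = i <;> by_cases h2 : ∃ j, u j = x <;> simp [h1, h2]

def actP {m n k : ℕ} (g : Equiv.Perm (Fin n)) (p : (Fin m ↪ Fin n) × (Fin n → Fin k)) :
    (Fin m ↪ Fin n) × (Fin n → Fin k) :=
  (p.1.trans g.toEmbedding, fun x => p.2 (g⁻¹ x))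

lemma card_fiber_comp {n k : ℕ} (f : Fin n → Fin k) (g : Equiv.Perm (Fin n)) (i : Fin k) :
    Nat.card {x // f (g x) = i} = Nat.card {x // f x = i} :=
  Nat.card_congr (g.subtypeEquiv fun _ => Iff.rfl)

lemma burnside_v {m n k : ℕ} (c : Fin k → ℤ) (hc : ∑ i, c i = n) (v : Fin m → Fin k) :
    (∑ g : Equiv.Perm (Fin n), ∑ p : (Fin m ↪ Fin n) × (Fin n → Fin k),
      if ((∀ i, ((Nat.card {x : Fin n // p.2 x = i} : ℕ) : ℤ) = c i) ∧ p.2 ∘ p.1 = v) ∧ actP g p = p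
      then (1:ℤ) else 0) = (n.factorial : ℤ) * if ∀ i, cont v i ≤ c i then 1 else 0 := by
  by_cases hv : ∀ i, cont v i ≤ c i
  · rw [if_pos hv, mul_one]
    -- construct p0
    have hc0 : ∀ i, 0 ≤ c i := fun i => (cont_nonneg v i).trans (hv i)
    obtain ⟨f0, hf0⟩ := exists_content (n := n) (fun i => (c i).toNat) (by
      zify
      rw [← hc]
      exact Finset.sum_congr rfl fun i _ => Int.toNat_of_nonneg (hc0 i))
    have hf0' : ∀ i, (Fintype.card {x // f0 x = i} : ℤ) = c i := by
      intro i; rw [hf0 i]; exact Int.toNat_of_nonneg (hc0 i)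
    have hemb : ∀ i, Nonempty ({j // v j = i} ↪ {x // f0 x = i}) := by
      intro i
      apply Function.Embedding.nonempty_of_card_le
      zify
      rw [hf0' i, card_eq_sum_ite]
      exact hv i
    let e : ∀ i, {j // v j = i} ↪ {x // f0 x = i} := fun i => (hemb i).some
    let u0 : Fin m ↪ Fin n := ⟨fun j => (e (v j) ⟨j, rfl⟩).1, by
      have key : ∀ i j (h : v j = i), (e (v j) ⟨j, rfl⟩).1 = (e i ⟨j, h⟩).1 := by
        rintro i j rfl; rfl
      intro j j' hjj
      have h1 : v j = v j' := by
        rw [← (e (v j) ⟨j, rfl⟩).2, ← (e (v j') ⟨j', rfl⟩).2]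
        exact congrArg f0 hjj
      beta_reduce at hjj
      rw [key (v j') j h1] at hjj
      have := (e (v j')).injective (Subtype.ext hjj)
      exact congrArg Subtype.val this⟩
    have hu0 : f0 ∘ u0 = v := by
      ext j; exact congrArg Fin.val (e (v j) ⟨j, rfl⟩).2
    rw [burnside_aux (G := Equiv.Perm (Fin n)) actP _ (fun p => (∀ i, ((Nat.card {x : Fin n // p.2 x = i} : ℕ) : ℤ) = c i) ∧ p.2 ∘ p.1 = v) (u0, f0)]
    · rw [Fintype.card_perm, Fintype.card_fin]
    · rintro ⟨u, f⟩ ⟨h1, h2⟩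
      simp only at h1 h2
      obtain ⟨g, hg⟩ := exists_perm_of_fiber (markF u0 f0) (markF u f) (by
        rintro (j | i)
        · simp only [markF_inl]; simp
        · zify
          rw [markF_card_inr, markF_card_inr, h2, hu0, h1 i, Nat.card_eq_fintype_card (α := {x // f0 x = i}), hf0' i])
      have hgu : ∀ j, g (u0 j) = u j := by
        intro j
        rw [← markF_inl u f, hg, markF_inl]
      refine ⟨g, ?_⟩
      refine Prod.ext ?_ ?_
      · ext j; exact congrArg Fin.val (hgu j)
      · funext x
        change f0 (g⁻¹ x) = f x
        obtain ⟨y, rfl⟩ := g.surjective x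
        rw [show g⁻¹ (g y) = y from g.symm_apply_apply y]
        by_cases hy : ∃ j, u0 j = y
        · obtain ⟨j, rfl⟩ := hy
          rw [hgu]
          have e1 := congrFun h2 j
          have e2 := congrFun hu0 j
          exact e2.trans e1.symm
        · have e1 := (markF_inr u0 f0 y (f0 y)).2 ⟨rfl, hy⟩
          rw [← hg y, markF_inr] at e1
          exact e1.1.symm
    · intro g
      refine ⟨fun i => ?_, ?_⟩
      · change ((Nat.card {x : Fin n // f0 (g⁻¹ x) = i} : ℕ) : ℤ) = c i
        rw [card_fiber_comp, Nat.card_eq_fintype_card, hf0']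
      · rw [← hu0]; ext j
        simp [actP]
    · intro g h x
      refine Prod.ext ?_ ?_
      · ext j; simp [actP]
      · funext y; simp [actP]
  · rw [if_neg hv, mul_zero]
    refine Finset.sum_eq_zero fun g _ => Finset.sum_eq_zero fun p _ => if_neg ?_
    rintro ⟨⟨h1, h2⟩, _⟩
    apply hv
    intro i
    have := markF_card_inr p.1 p.2 i
    rw [h2, h1 i] at this
    have h0 : (0:ℤ) ≤ (Nat.card {x // markF p.1 p.2 x = Sum.inr i} : ℤ) := Int.natCast_nonneg _
    linarith

theorem burnside_main {m n k : ℕ} (c : Fin k → ℤ) (hc : ∑ i, c i = n) :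
    (∑ g : Equiv.Perm (Fin n),
      (Fintype.card {u : Fin m ↪ Fin n // ∀ j, g (u j) = u j} : ℤ) * (fixedYoungFns n k c g⁻¹ : ℤ))
      = (n.factorial : ℤ) * Wc k m c := by
  unfold Wc
  rw [Finset.mul_sum]
  simp_rw [← burnside_v c hc]
  rw [Finset.sum_comm]
  refine Finset.sum_congr rfl fun g _ => ?_
  rw [Finset.sum_comm]
  unfold fixedYoungFns
  rw [Nat.card_eq_fintype_card, card_eq_sum_ite, card_eq_sum_ite, Finset.sum_mul_sum,
    Fintype.sum_prod_type]
  refine Finset.sum_congr rfl fun u _ => ?_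
  refine Finset.sum_congr rfl fun f _ => ?_
  obtain ⟨p, rfl, rfl⟩ : ∃ p : (Fin m ↪ Fin n) × (Fin n → Fin k), p.1 = u ∧ p.2 = f :=
    ⟨(u, f), rfl, rfl⟩
  rw [Finset.sum_eq_single (p.2 ∘ p.1)]
  · have : actP g p = p ↔ (∀ j, g (p.1 j) = p.1 j) ∧ ∀ x, p.2 (g⁻¹ x) = p.2 x := by
      rw [Prod.ext_iff, DFunLike.ext_iff, funext_iff]; rfl
    by_cases h1 : ∀ j, g (p.1 j) = p.1 j <;> simp [this, h1, and_comm]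
  · intro b _ hb
    rw [if_neg]
    rintro ⟨⟨_, h⟩, _⟩; exact hb h.symm
  · simp

end PartB


section PartC

lemma sum_rowLen (μ : YoungDiagram) : ∑ i : Fin μ.rowLens.length, μ.rowLen i = μ.card := by
  rw [Finset.sum_fin_eq_sum_range, YoungDiagram.length_rowLens]
  change _ = μ.cells.card
  rw [Finset.card_eq_sum_card_fiberwise (f := Prod.fst) (t := Finset.range (μ.colLen 0))]
  · refine Finset.sum_congr rfl fun i hi => ?_
    rw [Finset.mem_range] at hi
    rw [dif_pos hi, YoungDiagram.rowLen_eq_card]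
    rfl
  · rintro ⟨i, j⟩ hp
    have hp' : (i, j) ∈ μ := hp
    have : (i, 0) ∈ μ := μ.isLowerSet (show (i, 0) ≤ (i, j) from ⟨le_rfl, Nat.zero_le _⟩) hp
    simpa using YoungDiagram.mem_iff_lt_colLen.1 this

theorem sum_H_chi (n m : ℕ) (μ : YoungDiagram) (hμ : μ.card = n) (hm : m ≤ n) :
    (∑ g : Equiv.Perm (Fin n),
      (Fintype.card {u : Fin m ↪ Fin n // ∀ j, g (u j) = u j} : ℤ) * chi n μ g⁻¹)
      = (n.factorial : ℤ) * fS μ m := by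
  rw [fS_eq_Dk μ.rowLens.length m μ (by rw [YoungDiagram.length_rowLens]) (by omega)]
  unfold chi Dk
  simp_rw [Finset.mul_sum]
  rw [Finset.sum_comm]
  refine Finset.sum_congr rfl fun σ _ => ?_
  rw [mul_left_comm, ← burnside_main, Finset.mul_sum]
  · refine Finset.sum_congr rfl fun g _ => ?_
    ring
  · rw [Finset.sum_add_distrib, Finset.sum_sub_distrib]
    have h1 : ∑ i : Fin μ.rowLens.length, (((σ i : ℕ)) : ℤ) = ∑ i : Fin μ.rowLens.length, ((i : ℕ) : ℤ) :=
      Equiv.sum_comp σ (fun i : Fin μ.rowLens.length => ((i : ℕ) : ℤ))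
    rw [h1, ← hμ, ← sum_rowLen μ]
    push_cast
    ring

/-! ### permutations with descents in `T` -/

def pDes {m : ℕ} (T : Finset ℕ) (w : Equiv.Perm (Fin m)) : Prop :=
  ∀ i j : Fin m, (j : ℕ) = i + 1 → (j : ℕ) ∉ T → w i < w j

def blk (T : Finset ℕ) (i : ℕ) : ℕ := (T.filter (· ≤ i)).card

lemma blk_mono (T : Finset ℕ) : Monotone (blk T) := by
  intro i j h
  refine Finset.card_le_card fun t ht => ?_
  simp only [Finset.mem_filter] at ht ⊢
  exact ⟨ht.1, ht.2.trans h⟩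

lemma blk_succ_lt (T : Finset ℕ) (i : ℕ) (h : i + 1 ∈ T) : blk T i < blk T (i+1) := by
  refine Finset.card_lt_card ?_
  rw [Finset.ssubset_iff_of_subset]
  · exact ⟨i+1, by simp [h], by simp⟩
  · intro t ht
    simp only [Finset.mem_filter] at ht ⊢
    exact ⟨ht.1, by omega⟩

lemma blk_succ_eq (T : Finset ℕ) (i : ℕ) (h : i + 1 ∉ T) : blk T i = blk T (i+1) := by
  unfold blk
  congr 1
  ext t
  simp only [Finset.mem_filter]
  constructor
  · rintro ⟨h1, h2⟩; exact ⟨h1, by omega⟩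
  · rintro ⟨h1, h2⟩
    refine ⟨h1, ?_⟩
    have : t ≠ i + 1 := by rintro rfl; exact h h1
    omega

lemma pDes.lt {m : ℕ} {T : Finset ℕ} {w : Equiv.Perm (Fin m)} (h : pDes T w) :
    ∀ i j : Fin m, i < j → blk T i = blk T j → w i < w j := by
  have key : ∀ d : ℕ, ∀ i j : Fin m, (j : ℕ) = i + d + 1 → blk T i = blk T j → w i < w j := by
    intro d
    induction d with
    | zero =>
      intro i j hj hb
      refine h i j hj fun hT => ?_
      have := blk_succ_lt T i (by rw [← show (j : ℕ) = i + 1 by omega]; exact hT)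
      rw [hb, hj] at this
      exact lt_irrefl _ this
    | succ d ih =>
      intro i j hj hb
      let j' : Fin m := ⟨i + d + 1, by have := j.2; omega⟩
      have h1 : blk T i ≤ blk T j' := blk_mono T (by simp [j']; omega)
      have h2 : blk T j' ≤ blk T j := blk_mono T (by simp [j']; omega)
      refine (ih i j' rfl (by omega)).trans (h j' j (by simp [j']; omega) fun hT => ?_)
      have h3 := blk_succ_lt T j' (by rw [← show (j : ℕ) = j' + 1 by simp [j']; omega]; exact hT)
      rw [← show (j : ℕ) = j' + 1 by simp [j']; omega] at h3
      omega
  intro i j hij hb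
  exact key (j - i - 1) i j (by have : (i:ℕ) < j := hij; omega) hb

lemma pDes.eq_sort {m : ℕ} {T : Finset ℕ} {w : Equiv.Perm (Fin m)} (h : pDes T w) :
    w = Tuple.sort (fun p => blk T (w.symm p)) := by
  rw [Tuple.eq_sort_iff]
  constructor
  · intro i j hij
    simp only [Function.comp, Equiv.symm_apply_apply]
    exact blk_mono T hij
  · intro i j hij hb
    simp only [Equiv.symm_apply_apply] at hb
    exact h.lt i j hij hb

/-! ### families of words -/

def Fam (n : ℕ) (T : Finset ℕ) (g : Equiv.Perm (Fin n)) : Type :=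
  {x : T → InjWord n // (∀ t, (x t).1.length = t) ∧ (∀ s t : T, (s : ℕ) ≤ t → x s ≤ x t) ∧
    ∀ t, permWord g (x t) = x t}

noncomputable def subW {n m : ℕ} (u : Fin m ↪ Fin n) (p : Fin m → Prop) : InjWord n :=
  ⟨((List.finRange m).filter (fun i => decide (p i))).map u,
    ((List.nodup_finRange m).filter _).map u.injective⟩

lemma mem_subW {n m : ℕ} (u : Fin m ↪ Fin n) (p : Fin m → Prop) (i : Fin m) :
    u i ∈ (subW u p).1 ↔ p i := by
  simp [subW]

lemma length_subW {n m : ℕ} (u : Fin m ↪ Fin n) (p : Fin m → Prop) :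
    (subW u p).1.length = (Finset.univ.filter p).card := by
  unfold subW
  rw [List.length_map, ← List.toFinset_card_of_nodup ((List.nodup_finRange m).filter _)]
  congr 1
  ext i; simp

lemma card_lt_fin (m t : ℕ) (h : t ≤ m) : (Finset.univ.filter fun i : Fin m => (i : ℕ) < t).card = t := by
  rw [Fin.card_filter_val_lt]; omega

lemma card_symm_lt (m t : ℕ) (h : t ≤ m) (w : Equiv.Perm (Fin m)) :
    (Finset.univ.filter fun i : Fin m => (w.symm i : ℕ) < t).card = t := by
  refine Eq.trans ?_ (card_lt_fin m t h)
  refine Finset.card_bij (fun i _ => w.symm i) ?_ ?_ ?_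
  · intro i hi; simpa using hi
  · intro i _ j _ hij; exact w.symm.injective hij
  · intro i hi; exact ⟨w i, by simpa using hi, by simp⟩

lemma sublist_eq_filter {α : Type*} {l1 l2 : List α} (h : l1.Sublist l2) (hn : l2.Nodup) :
    l1 = l2.filter (fun a => decide (a ∈ l1)) := by
  have h1 : l1.Sublist (l2.filter (fun a => decide (a ∈ l1))) := by
    have := h.filter (fun a => decide (a ∈ l1))
    rwa [List.filter_eq_self.2 (by simp)] at this
  refine h1.eq_of_length ?_
  refine List.Perm.length_eq ?_
  rw [List.perm_ext_iff_of_nodup (hn.sublist h) (hn.filter _)]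
  intro a
  simp only [List.mem_filter, decide_eq_true_eq]
  exact ⟨fun ha => ⟨h.subset ha, ha⟩, fun ha => ha.2⟩

noncomputable def famMap {n m : ℕ} (T : Finset ℕ) (hT : ∀ t ∈ T, t ≤ m) (g : Equiv.Perm (Fin n))
    (p : {u : Fin m ↪ Fin n // ∀ j, g (u j) = u j} × {w : Equiv.Perm (Fin m) // pDes T w}) :
    Fam n T g :=
  ⟨fun t => subW p.1.1 (fun i => (p.2.1.symm i : ℕ) < t), by
    refine ⟨fun t => ?_, fun s t hst => ?_, fun t => ?_⟩
    · rw [length_subW]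
      convert card_symm_lt m t (hT t t.2) p.2.1
    · refine List.Sublist.map _ ?_
      refine List.monotone_filter_right _ fun i hi => ?_
      simp only [decide_eq_true_eq] at hi ⊢
      omega
    · refine Subtype.ext ?_
      simp only [permWord, subW, List.map_map]
      refine List.map_congr_left fun i _ => ?_
      exact p.1.2 i⟩

lemma famMap_bij {n m : ℕ} (T : Finset ℕ) (hT : ∀ t ∈ T, t ≤ m) (hm : m ∈ T)
    (g : Equiv.Perm (Fin n)) : Function.Bijective (famMap (n := n) T hT g) := by
  constructor
  · rintro ⟨⟨u, hu⟩, ⟨w, hw⟩⟩ ⟨⟨u', hu'⟩, ⟨w', hw'⟩⟩ heq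
    have he : ∀ t (ht : t ∈ T), subW u (fun i => (w.symm i : ℕ) < t) = subW u' (fun i => (w'.symm i : ℕ) < t) :=
      fun t ht => congrFun (congrArg Subtype.val heq) ⟨t, ht⟩
    have hu : u = u' := by
      have := congrArg Subtype.val (he m hm)
      simp only [subW, Fin.is_lt, decide_true, List.filter_true] at this
      ext i
      rw [List.map_inj_left.1 this i (List.mem_finRange i)]
    subst hu
    have hw2 : w = w' := by
      rw [hw.eq_sort, hw'.eq_sort]
      congr 1
      funext i
      unfold blk
      congr 1
      ext t
      simp only [Finset.mem_filter, and_congr_right_iff]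
      intro ht
      rw [← not_lt, ← not_lt, ← mem_subW u (fun i => (w.symm i : ℕ) < t) i, he t ht, mem_subW]
    subst hw2
    rfl
  · rintro ⟨x, hlen, hmono, hfix⟩
    let M : T := ⟨m, hm⟩
    have hlm : (x M).1.length = m := hlen M
    let u : Fin m ↪ Fin n := ⟨fun i => (x M).1.get (i.cast hlm.symm), fun i j hij => by
      have := (List.nodup_iff_injective_get.1 (x M).2) hij
      simpa using this⟩
    have hxM : (x M).1 = (List.finRange m).map u := by
      refine List.ext_get (by simp [hlm]) fun i h1 h2 => ?_
      simp [u]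
      rfl
    have hug : ∀ j, g (u j) = u j := by
      intro j
      have := congrArg Subtype.val (hfix M)
      simp only [permWord] at this
      rw [hxM, List.map_map] at this
      exact List.map_inj_left.1 this j (List.mem_finRange j)
    have hxt : ∀ t : T, x t = subW u (fun i => u i ∈ (x t).1) := by
      intro t
      refine Subtype.ext ?_
      have hs : (x t).1.Sublist (x M).1 := hmono t M (hT t t.2)
      have h1 := sublist_eq_filter hs (x M).2
      conv_lhs => rw [h1, hxM]
      unfold subW
      rw [List.filter_map]
      refine congrArg (List.map u) (List.filter_congr fun i _ => ?_)
      simp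
    let f : Fin m → ℕ := fun i => (T.attach.filter fun t => u i ∉ (x t).1).card
    let w := Tuple.sort f
    have hXlow : ∀ (t : T) (p q : Fin m), u q ∈ (x t).1 → f p ≤ f q → u p ∈ (x t).1 := by
      intro t p q hq hf
      by_contra hp
      have : f q < f p := by
        refine Finset.card_lt_card ?_
        rw [Finset.ssubset_iff_of_subset]
        · exact ⟨t, by simp [hp], by simp [hq]⟩
        · intro s hs
          simp only [Finset.mem_filter, Finset.mem_attach, true_and] at hs ⊢
          rcases le_total (s : ℕ) t with hst | hst
          · exact fun hh => hp (List.Sublist.subset (show (x s).1.Sublist (x t).1 from hmono s t hst) hh)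
          · exact absurd (List.Sublist.subset (show (x t).1.Sublist (x s).1 from hmono t s hst) hq) hs
      omega
    have hfm : Monotone (f ∘ w) := Tuple.monotone_sort f
    have hlowset : ∀ (t : T) (i j : Fin m), i ≤ j → u (w j) ∈ (x t).1 → u (w i) ∈ (x t).1 :=
      fun t i j hij hj => hXlow t (w i) (w j) hj (hfm hij)
    have hcard : ∀ t : T, (Finset.univ.filter fun i : Fin m => u (w i) ∈ (x t).1).card = t := by
      intro t
      rw [← hlen t]
      conv_rhs => rw [hxt t, length_subW]
      refine Finset.card_bij (fun i _ => w i) ?_ ?_ ?_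
      · intro i hi; simpa using hi
      · intro i _ j _ hij; exact w.injective hij
      · intro i hi; exact ⟨w.symm i, by simpa using hi, by simp⟩
    have hiff : ∀ (t : T) (i : Fin m), u (w i) ∈ (x t).1 ↔ (i : ℕ) < t := by
      intro t i
      constructor
      · intro hi
        have : (Finset.univ.filter fun j : Fin m => (j : ℕ) < i + 1).card ≤
            (Finset.univ.filter fun i : Fin m => u (w i) ∈ (x t).1).card := by
          refine Finset.card_le_card fun j hj => ?_
          simp only [Finset.mem_filter, Finset.mem_univ, true_and] at hj ⊢
          exact hlowset t j i (by rw [Fin.le_def]; omega) hi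
        rw [hcard, card_lt_fin _ _ (by omega)] at this
        omega
      · intro hi
        by_contra hcon
        have : (Finset.univ.filter fun i : Fin m => u (w i) ∈ (x t).1).card ≤
            (Finset.univ.filter fun j : Fin m => (j : ℕ) < i).card := by
          refine Finset.card_le_card fun j hj => ?_
          simp only [Finset.mem_filter, Finset.mem_univ, true_and] at hj ⊢
          by_contra hji
          exact hcon (hlowset t i j (by rw [Fin.le_def]; omega) hj)
        rw [hcard, card_lt_fin _ _ (by omega)] at this
        omega
    have hw : pDes T w := by
      intro i j hj hjT
      refine (Tuple.eq_sort_iff.1 (rfl : w = Tuple.sort f)).2 i j (by rw [Fin.lt_def]; omega) ?_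
      simp only [f]
      congr 1
      ext t
      simp only [Finset.mem_filter, Finset.mem_attach, true_and, hiff]
      have : (t : ℕ) ≠ j := by rintro h; exact hjT (h ▸ t.2)
      omega
    refine ⟨(⟨u, hug⟩, ⟨w, hw⟩), ?_⟩
    refine Subtype.ext (funext fun t => ?_)
    simp only [famMap]
    rw [hxt t]
    congr 1
    funext i
    rw [← hiff t, Equiv.apply_symm_apply]

theorem card_Fam {n m : ℕ} (T : Finset ℕ) (hT : ∀ t ∈ T, t ≤ m) (hm : m ∈ T)
    (g : Equiv.Perm (Fin n)) : Nat.card (Fam n T g) =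
    Fintype.card {u : Fin m ↪ Fin n // ∀ j, g (u j) = u j} *
      Nat.card {w : Equiv.Perm (Fin m) // pDes T w} := by
  rw [← Nat.card_congr (Equiv.ofBijective _ (famMap_bij T hT hm g)), Nat.card_prod,
    Nat.card_eq_fintype_card]

end PartC


section PartD

lemma sublist_interp {α : Type*} {u v : List α} (h : u.Sublist v) :
    ∀ t, u.length ≤ t → t ≤ v.length → ∃ y : List α, u.Sublist y ∧ y.Sublist v ∧ y.length = t := by
  induction h with
  | slnil => intro t _ h2; exact ⟨[], by simp, by simp, by simp at h2; simp [h2]⟩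
  | @cons l1 l2 a h ih =>
    intro t h1 h2
    by_cases ht : t ≤ l2.length
    · obtain ⟨y, hy1, hy2, hy3⟩ := ih t h1 ht
      exact ⟨y, hy1, hy2.cons a, hy3⟩
    · refine ⟨a :: l2, h.cons a, List.Sublist.refl _, ?_⟩
      simp at h2 ⊢; omega
  | @cons_cons l1 l2 a h ih =>
    intro t h1 h2
    simp at h1 h2
    obtain ⟨y, hy1, hy2, hy3⟩ := ih (t-1) (by omega) (by omega)
    exact ⟨a :: y, hy1.cons_cons a, hy2.cons_cons a, by simp; omega⟩

instance finite_InjWord (n : ℕ) : Finite (InjWord n) := by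
  unfold InjWord
  infer_instance

lemma InjWord.eq_of_le {n : ℕ} {u v : InjWord n} (h : u ≤ v) (hl : v.1.length ≤ u.1.length) : u = v :=
  Subtype.ext (List.Sublist.eq_of_length_le h hl)

lemma InjWord.length_le {n : ℕ} {u v : InjWord n} (h : u ≤ v) : u.1.length ≤ v.1.length :=
  List.Sublist.length_le h

lemma InjWord.interp {n : ℕ} {u v : InjWord n} (h : u ≤ v) (t : ℕ) (h1 : u.1.length ≤ t)
    (h2 : t ≤ v.1.length) : ∃ y : InjWord n, u ≤ y ∧ y ≤ v ∧ y.1.length = t := by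
  obtain ⟨y, hy1, hy2, hy3⟩ := sublist_interp (show u.1.Sublist v.1 from h) t h1 h2
  exact ⟨⟨y, v.2.sublist hy2⟩, hy1, hy2, hy3⟩

lemma InjWord.ext_full {n : ℕ} (u : InjWord n) : ∃ v : InjWord n, u ≤ v ∧ n ≤ v.1.length := by
  refine ⟨⟨u.1 ++ (List.finRange n).filter (fun a => decide (a ∉ u.1)), ?_⟩, ?_, ?_⟩
  · refine List.Nodup.append u.2 ((List.nodup_finRange n).filter _) ?_
    intro a h1 h2
    simp at h2
    exact h2 h1
  · exact List.sublist_append_left _ _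
  · have : (List.finRange n).length ≤ (u.1 ++ (List.finRange n).filter (fun a => decide (a ∉ u.1))).length := by
      refine List.Subperm.length_le (List.subperm_of_subset (List.nodup_finRange n) ?_)
      intro a _
      by_cases h : a ∈ u.1 <;> simp [h]
    simpa using this

lemma rkInj_coe (n : ℕ) (u : InjWord n) : rkInj n (u : WithTop (InjWord n)) = u.1.length := rfl

lemma mem_rankSel_coe (n : ℕ) (T : Finset ℕ) (u : InjWord n) :
    (u : WithTop (InjWord n)) ∈ rankSel (rkInj n) T ↔ u.1.length ∈ insert 0 T := by
  have : (u : WithTop (InjWord n)) = ⊥ ↔ u.1.length = 0 := by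
    rw [← WithTop.coe_bot, WithTop.coe_inj, List.length_eq_zero_iff]
    exact Subtype.ext_iff
  simp [rankSel, rkInj_coe, this, or_comm]

lemma top_mem_rankSel (n : ℕ) (T : Finset ℕ) : (⊤ : WithTop (InjWord n)) ∈ rankSel (rkInj n) T := by
  simp [rankSel]

lemma mem_of_comparable {P : Type*} [PartialOrder P] {A C : Set P} (hC : C ∈ maxChainsIn A)
    (y : P) (hy : y ∈ A) (h : ∀ z ∈ C, z ≤ y ∨ y ≤ z) : y ∈ C := by
  have : C = insert y C := by
    refine hC.2.2 _ (Set.insert_subset hy hC.1) ?_ (Set.subset_insert _ _)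
    refine hC.2.1.insert fun z hz _ => ?_
    exact (h z hz).symm
  rw [this]
  exact Set.mem_insert _ _

lemma comparable_of_chain {n : ℕ} {C : Set (WithTop (InjWord n))} (hC : IsChain (· ≤ ·) C)
    {u v : InjWord n} (hu : (u : WithTop (InjWord n)) ∈ C) (hv : (v : WithTop (InjWord n)) ∈ C)
    (h : u.1.length ≤ v.1.length) : u ≤ v := by
  rcases hC.total hu hv with h1 | h1
  · exact WithTop.coe_le_coe.1 h1
  · rw [InjWord.eq_of_le (WithTop.coe_le_coe.1 h1) h]

lemma exists_rank_mem {n : ℕ} {T : Finset ℕ} {C : Set (WithTop (InjWord n))}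
    (hC : C ∈ maxChainsIn (rankSel (rkInj n) T)) (t : ℕ) (ht : t ∈ insert 0 T) (htn : t ≤ n) :
    ∃ y : InjWord n, (y : WithTop (InjWord n)) ∈ C ∧ y.1.length = t := by
  have hbot : ((⊥ : InjWord n) : WithTop (InjWord n)) ∈ C := by
    refine mem_of_comparable hC _ ?_ fun z _ => Or.inr ?_
    · rw [mem_rankSel_coe]; exact Finset.mem_insert_self _ _
    · rw [WithTop.coe_bot]; exact bot_le
  obtain ⟨u, ⟨hu1, hu2⟩, hu3⟩ := Set.exists_max_image
    {u : InjWord n | (u : WithTop (InjWord n)) ∈ C ∧ u.1.length ≤ t} (fun u => u.1.length)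
    (Set.toFinite _) ⟨⊥, hbot, Nat.zero_le _⟩
  have hv : ∃ v : InjWord n, u ≤ v ∧ t ≤ v.1.length ∧
      ∀ z : InjWord n, (z : WithTop (InjWord n)) ∈ C → t ≤ z.1.length → v ≤ z := by
    by_cases hB : {v : InjWord n | (v : WithTop (InjWord n)) ∈ C ∧ t ≤ v.1.length}.Nonempty
    · obtain ⟨v, ⟨hv1, hv2⟩, hv3⟩ := Set.exists_min_image
        {v : InjWord n | (v : WithTop (InjWord n)) ∈ C ∧ t ≤ v.1.length} (fun u => u.1.length)
        (Set.toFinite _) hB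
      refine ⟨v, comparable_of_chain hC.2.1 hu1 hv1 (hu2.trans hv2), hv2, fun z hz1 hz2 => ?_⟩
      exact comparable_of_chain hC.2.1 hv1 hz1 (hv3 z ⟨hz1, hz2⟩)
    · obtain ⟨v, hv1, hv2⟩ := u.ext_full
      exact ⟨v, hv1, htn.trans hv2, fun z hz1 hz2 => absurd ⟨z, hz1, hz2⟩ hB⟩
  obtain ⟨v, hv1, hv2, hv3⟩ := hv
  obtain ⟨y, hy1, hy2, hy3⟩ := InjWord.interp hv1 t hu2 hv2
  refine ⟨y, mem_of_comparable hC _ ?_ ?_, hy3⟩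
  · rw [mem_rankSel_coe, hy3]; exact ht
  · intro z hz
    induction z using WithTop.recTopCoe with
    | top => exact Or.inr le_top
    | coe z =>
      rw [WithTop.coe_le_coe, WithTop.coe_le_coe]
      rcases le_total z.1.length t with h | h
      · left
        exact (comparable_of_chain hC.2.1 hz hu1 (hu3 z ⟨hz, h⟩)).trans hy1
      · right
        exact hy2.trans (hv3 z hz h)

def chainOf {n : ℕ} {T : Finset ℕ} (x : T → InjWord n) : Set (WithTop (InjWord n)) :=
  insert ⊤ (Set.range fun t => (x t : WithTop (InjWord n)))

lemma coe_mem_chainOf {n : ℕ} {T : Finset ℕ} (x : T → InjWord n) (u : InjWord n) :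
    (u : WithTop (InjWord n)) ∈ chainOf x ↔ ∃ t, x t = u := by
  simp [chainOf]

lemma chainOf_max {n : ℕ} {T : Finset ℕ} (x : (insert 0 T : Finset ℕ) → InjWord n)
    (hl : ∀ t, (x t).1.length = t) (hm : ∀ s t : (insert 0 T : Finset ℕ), (s : ℕ) ≤ t → x s ≤ x t) :
    chainOf x ∈ maxChainsIn (rankSel (rkInj n) T) := by
  refine ⟨?_, ?_, ?_⟩
  · intro z hz
    induction z using WithTop.recTopCoe with
    | top => exact top_mem_rankSel n T
    | coe z =>
      obtain ⟨t, rfl⟩ := (coe_mem_chainOf x z).1 hz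
      rw [mem_rankSel_coe, hl]
      exact t.2
  · refine IsChain.insert ?_ fun z _ _ => Or.inr le_top
    rintro _ ⟨s, rfl⟩ _ ⟨t, rfl⟩ _
    simp only [WithTop.coe_le_coe]
    rcases le_total (s : ℕ) t with h | h
    · exact Or.inl (hm s t h)
    · exact Or.inr (hm t s h)
  · intro D hD1 hD2 hD3
    refine Set.Subset.antisymm hD3 fun z hz => ?_
    induction z using WithTop.recTopCoe with
    | top => exact Set.mem_insert _ _
    | coe z =>
      rw [coe_mem_chainOf]
      refine ⟨⟨z.1.length, (mem_rankSel_coe n T z).1 (hD1 hz)⟩, ?_⟩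
      refine InjWord.eq_of_le (comparable_of_chain hD2 (hD3 ((coe_mem_chainOf x _).2 ⟨_, rfl⟩)) hz ?_) ?_
      · rw [hl]
      · rw [hl]

lemma length_permWord {n : ℕ} (g : Equiv.Perm (Fin n)) (u : InjWord n) :
    (permWord g u).1.length = u.1.length := by simp [permWord]

theorem injAlpha_eq {n : ℕ} (T : Finset ℕ) (hT : ∀ t ∈ T, t ≤ n) (g : Equiv.Perm (Fin n)) :
    injAlpha n T g = (Nat.card (Fam n (insert 0 T) g) : ℤ) := by
  unfold injAlpha gAlpha
  rw [← Nat.card_coe_set_eq]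
  congr 1
  symm
  refine Nat.card_eq_of_bijective (fun x => ⟨chainOf x.1, chainOf_max x.1 x.2.1 x.2.2.1, ?_⟩) ⟨?_, ?_⟩
  · rw [chainOf, Set.image_insert_eq, ← Set.range_comp]
    congr 1
    congr 1
    funext t
    exact congrArg _ (x.2.2.2 t)
  · rintro x y hxy
    have h : chainOf x.1 = chainOf y.1 := congrArg Subtype.val hxy
    refine Subtype.ext (funext fun t => ?_)
    have h1 : (x.1 t : WithTop (InjWord n)) ∈ chainOf y.1 := by
      rw [← h, coe_mem_chainOf]; exact ⟨t, rfl⟩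
    obtain ⟨s, hs⟩ := (coe_mem_chainOf _ _).1 h1
    have : s = t := by
      apply Subtype.ext
      rw [← x.2.1 t, ← hs, y.2.1 s]
    rw [← hs, this]
  · rintro ⟨C, hC, hg⟩
    have hle : ∀ t ∈ insert 0 T, t ≤ n := by
      intro t ht
      rcases Finset.mem_insert.1 ht with rfl | ht
      · exact Nat.zero_le _
      · exact hT t ht
    choose x hx1 hx2 using fun t : (insert 0 T : Finset ℕ) => exists_rank_mem hC t.1 t.2 (hle t.1 t.2)
    have hm : ∀ s t : (insert 0 T : Finset ℕ), (s : ℕ) ≤ t → x s ≤ x t := fun s t hst =>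
      comparable_of_chain hC.2.1 (hx1 s) (hx1 t) (by rw [hx2, hx2]; exact hst)
    refine ⟨⟨x, hx2, hm, fun t => ?_⟩, Subtype.ext ?_⟩
    · have : (permWord g (x t) : WithTop (InjWord n)) ∈ C := by
        rw [← hg]
        exact ⟨_, hx1 t, rfl⟩
      refine InjWord.eq_of_le (comparable_of_chain hC.2.1 this (hx1 t) ?_) ?_ <;> rw [length_permWord]
    · refine (chainOf_max x hx2 hm).2.2 C hC.1 hC.2.1 ?_
      intro z hz
      induction z using WithTop.recTopCoe with
      | top => exact mem_of_comparable hC _ (top_mem_rankSel n T) fun z _ => Or.inl le_top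
      | coe z =>
        obtain ⟨t, rfl⟩ := (coe_mem_chainOf x z).1 hz
        exact hx1 t

end PartD


section PartE

lemma permApp_succ {n : ℕ} (w : Equiv.Perm (Fin n)) (i : Fin n) : permApp w (i + 1) = w i + 1 := by
  unfold permApp
  rw [dif_pos (by simp)]
  simp

lemma mem_descentSet {n : ℕ} (w : Equiv.Perm (Fin n)) (d : ℕ) :
    d ∈ descentSet w ↔ ∃ i j : Fin n, (j : ℕ) = i + 1 ∧ d = j ∧ w j < w i := by
  unfold descentSet
  rw [Finset.mem_filter, Finset.mem_Icc]
  constructor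
  · rintro ⟨⟨h1, h2⟩, h3⟩
    let i : Fin n := ⟨d - 1, by omega⟩
    let j : Fin n := ⟨d, by omega⟩
    have e1 := permApp_succ w i
    have e2 := permApp_succ w j
    have : (i : ℕ) + 1 = d := by simp [i]; omega
    rw [this] at e1
    rw [show ((j : ℕ) + 1) = d + 1 from rfl] at e2
    refine ⟨i, j, by rw [this], rfl, ?_⟩
    rw [Fin.lt_def]
    omega
  · rintro ⟨i, j, h1, rfl, h3⟩
    have e1 := permApp_succ w i
    have e2 := permApp_succ w j
    rw [← h1] at e1
    rw [Fin.lt_def] at h3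
    have := j.2
    refine ⟨by omega, by omega⟩

lemma swap_lt_iff {n : ℕ} {a b : Fin n} (hab : (b : ℕ) = a + 1) (x y : Fin n)
    (h1 : ¬ (x = a ∧ y = b)) (h2 : ¬ (x = b ∧ y = a)) :
    Equiv.swap a b x < Equiv.swap a b y ↔ x < y := by
  rw [Equiv.swap_apply_def, Equiv.swap_apply_def]
  simp only [Fin.ext_iff] at h1 h2 ⊢
  split_ifs <;> simp only [Fin.lt_def] <;> omega

lemma wS_step
    {n : ℕ} {S : Finset ℕ} {wS : Equiv.Perm (Fin n)} (hwS : descentSet wS = S)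
    (hwSmax : ∀ v : Equiv.Perm (Fin n), descentSet v = S → invCount v ≤ invCount wS)
    (p q : Fin n) (hv : (wS q : ℕ) = wS p + 1) : blk S q ≤ blk S p := by
  by_contra hcon
  push Not at hcon
  have hpq : p < q := by
    by_contra h
    have := blk_mono S (show (q : ℕ) ≤ p by simpa using h)
    omega
  have key : ∀ i j : Fin n, ¬ (i = p ∧ j = q) → ¬ (i = q ∧ j = p) →
      ((Equiv.swap (wS p) (wS q) * wS) j < (Equiv.swap (wS p) (wS q) * wS) i ↔ wS j < wS i) := by
    intro i j h1 h2
    simp only [Equiv.Perm.mul_apply]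
    refine swap_lt_iff hv _ _ ?_ ?_
    · rintro ⟨h3, h4⟩; exact h2 ⟨wS.injective h4, wS.injective h3⟩
    · rintro ⟨h3, h4⟩; exact h1 ⟨wS.injective h4, wS.injective h3⟩
  have hd : descentSet (Equiv.swap (wS p) (wS q) * wS) = S := by
    rw [← hwS]
    ext d
    rw [mem_descentSet, mem_descentSet]
    refine exists_congr fun i => exists_congr fun j => and_congr_right fun hij => and_congr_right fun _ => ?_
    refine key i j ?_ ?_
    · rintro ⟨rfl, rfl⟩
      have hS : (i : ℕ) + 1 ∈ S := by
        by_contra h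
        have := blk_succ_eq S i h
        rw [← hij] at this
        omega
      rw [← hwS, mem_descentSet] at hS
      obtain ⟨i', j', h1, h2, h3⟩ := hS
      have : i' = i := Fin.ext (by omega)
      subst this
      have : j' = j := Fin.ext (by omega)
      subst this
      rw [Fin.lt_def] at h3
      omega
    · rintro ⟨rfl, rfl⟩
      rw [Fin.lt_def] at hpq
      omega
  have h1 := hwSmax _ hd
  have h2 : invCount wS < invCount (Equiv.swap (wS p) (wS q) * wS) := by
    refine Finset.card_lt_card ?_
    rw [Finset.ssubset_iff_of_subset]
    · refine ⟨(p, q), ?_, ?_⟩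
      · refine Finset.mem_filter.2 ⟨Finset.mem_univ _, hpq, ?_⟩
        simp only [Equiv.Perm.mul_apply, Equiv.swap_apply_left, Equiv.swap_apply_right]
        rw [Fin.lt_def]; omega
      · simp only [Finset.mem_filter, Finset.mem_univ, true_and, not_and, not_lt]
        intro _
        rw [Fin.le_def]; omega
    · rintro ⟨a, b⟩ hab
      simp only [Finset.mem_filter, Finset.mem_univ, true_and] at hab ⊢
      refine ⟨hab.1, (key a b ?_ ?_).2 hab.2⟩
      · rintro ⟨rfl, rfl⟩
        have := hab.2
        rw [Fin.lt_def] at this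
        omega
      · rintro ⟨rfl, rfl⟩
        exact lt_asymm hpq hab.1
  omega

lemma wS_anti
    {n : ℕ} {S : Finset ℕ} {wS : Equiv.Perm (Fin n)} (hwS : descentSet wS = S)
    (hwSmax : ∀ v : Equiv.Perm (Fin n), descentSet v = S → invCount v ≤ invCount wS)
    (p q : Fin n) (h : wS p ≤ wS q) : blk S q ≤ blk S p := by
  have key : ∀ d : ℕ, ∀ p q : Fin n, (wS q : ℕ) = wS p + d → blk S q ≤ blk S p := by
    intro d
    induction d with
    | zero =>
      intro p q h
      have : q = p := wS.injective (Fin.ext (by omega))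
      rw [this]
    | succ d ih =>
      intro p q h
      let r : Fin n := wS.symm ⟨wS p + d, by have := (wS q).2; omega⟩
      have hr : (wS r : ℕ) = wS p + d := by simp [r]
      exact (wS_step hwS hwSmax r q (by omega)).trans (ih p r hr)
  exact key (wS q - wS p) p q (by rw [Fin.le_def] at h; omega)

lemma wS_cross
    {n : ℕ} {S : Finset ℕ} {wS : Equiv.Perm (Fin n)} (hwS : descentSet wS = S)
    (hwSmax : ∀ v : Equiv.Perm (Fin n), descentSet v = S → invCount v ≤ invCount wS)
    {m : ℕ} (hm : m ∈ insert 0 S) (p q : Fin n) (hp : (p : ℕ) < m) (hq : m ≤ q) :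
    wS q < wS p := by
  have hmS : m ∈ S := by
    rcases Finset.mem_insert.1 hm with h | h
    · omega
    · exact h
  by_contra h
  have h1 := wS_anti hwS hwSmax p q (not_lt.1 h)
  have h2 := blk_succ_lt S (m-1) (by rwa [Nat.sub_add_cancel (by omega)])
  rw [Nat.sub_add_cancel (by omega)] at h2
  have h3 := blk_mono S (show (p : ℕ) ≤ m - 1 by omega)
  have h4 := blk_mono S hq
  omega

lemma wS_high
    {n : ℕ} {S : Finset ℕ} {wS : Equiv.Perm (Fin n)} (hwS : descentSet wS = S)
    (hwSmax : ∀ v : Equiv.Perm (Fin n), descentSet v = S → invCount v ≤ invCount wS)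
    {m : ℕ} (hm : m ∈ insert 0 S) (p : Fin n) (hp : (p : ℕ) < m) :
    n - m ≤ wS p := by
  have h : ((Finset.univ.filter fun q : Fin n => ¬ (q : ℕ) < m)).card ≤ (Finset.Iio (wS p)).card := by
    refine Finset.card_le_card_of_injOn wS ?_ wS.injective.injOn
    intro q hq
    simp at hq
    simpa using wS_cross hwS hwSmax hm p q hp hq
  rw [Fin.card_Iio] at h
  have h2 := Finset.card_filter_add_card_filter_not (s := (Finset.univ : Finset (Fin n))) (fun q : Fin n => (q : ℕ) < m)
  rw [Fin.card_filter_val_lt, Finset.card_univ, Fintype.card_fin] at h2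
  omega

lemma wS_low
    {n : ℕ} {S : Finset ℕ} {wS : Equiv.Perm (Fin n)} (hwS : descentSet wS = S)
    (hwSmax : ∀ v : Equiv.Perm (Fin n), descentSet v = S → invCount v ≤ invCount wS)
    {m : ℕ} (hm : m ∈ insert 0 S) (q : Fin n) (hq : m ≤ (q : ℕ)) :
    (wS q : ℕ) < n - m := by
  have h : ((Finset.univ.filter fun q : Fin n => (q : ℕ) < m)).card ≤ (Finset.Ioi (wS q)).card := by
    refine Finset.card_le_card_of_injOn wS ?_ wS.injective.injOn
    intro p hp
    simp at hp
    simpa using wS_cross hwS hwSmax hm p q hp hq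
  rw [Fin.card_Ioi, Fin.card_filter_val_lt] at h
  have := q.2
  have := (wS q).2
  omega

def agree {n : ℕ} (wS : Equiv.Perm (Fin n)) (m : ℕ) (w : Equiv.Perm (Fin n)) : Prop :=
  ∀ q : Fin n, m ≤ (q : ℕ) → w q = wS q

lemma agree_high
    {n : ℕ} {S : Finset ℕ} {wS : Equiv.Perm (Fin n)} (hwS : descentSet wS = S)
    (hwSmax : ∀ v : Equiv.Perm (Fin n), descentSet v = S → invCount v ≤ invCount wS)
    {m : ℕ} (hm : m ∈ insert 0 S) {w : Equiv.Perm (Fin n)} (hw : agree wS m w)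
    (p : Fin n) (hp : (p : ℕ) < m) : n - m ≤ w p := by
  let p' := wS.symm (w p)
  have hp' : wS p' = w p := by simp [p']
  rw [← hp']
  refine wS_high hwS hwSmax hm p' ?_
  by_contra h
  have := hw p' (not_lt.1 h)
  rw [hp'] at this
  have := w.injective this
  rw [this] at h
  exact h hp

theorem card_pDes
    {n : ℕ} {S : Finset ℕ} {wS : Equiv.Perm (Fin n)} (hwS : descentSet wS = S)
    (hwSmax : ∀ v : Equiv.Perm (Fin n), descentSet v = S → invCount v ≤ invCount wS)
    {m : ℕ} (hmn : m ≤ n) (hm : m ∈ insert 0 S) (T : Finset ℕ) :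
    Nat.card {w : Equiv.Perm (Fin m) // pDes (insert 0 T) w} =
    Nat.card {w : Equiv.Perm (Fin n) // agree wS m w ∧ ∀ d ∈ descentSet w, d < m → d ∈ T} := by
  symm
  have hex : ∀ w : {w : Equiv.Perm (Fin n) // agree wS m w ∧ ∀ d ∈ descentSet w, d < m → d ∈ T},
      ∃ w' : {w : Equiv.Perm (Fin m) // pDes (insert 0 T) w},
        ∀ i : Fin m, (w.1 (Fin.castLE hmn i) : ℕ) = (n - m) + w'.1 i := by
    rintro ⟨w, hw1, hw2⟩
    have hh : ∀ i : Fin m, n - m ≤ w (Fin.castLE hmn i) := fun i =>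
      agree_high hwS hwSmax hm hw1 _ (by simp)
    let f : Fin m → Fin m := fun i => ⟨w (Fin.castLE hmn i) - (n - m), by
      have := (w (Fin.castLE hmn i)).2
      have := i.2
      have := hh i
      omega⟩
    have hf : ∀ i, (w (Fin.castLE hmn i) : ℕ) = (n - m) + f i := by
      intro i
      have := hh i
      simp only [f]; omega
    have hinj : Function.Injective f := by
      intro i j hij
      have h1 := hf i
      rw [hij, ← hf j] at h1
      have := w.injective (Fin.ext h1)
      simpa using this
    refine ⟨⟨Equiv.ofBijective f (Finite.injective_iff_bijective.1 hinj), ?_⟩, hf⟩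
    intro i j hij hjT
    simp only [Equiv.ofBijective_apply]
    by_contra hcon
    have hne : f i ≠ f j := fun h => by
      have := hinj h
      rw [this] at hij; omega
    have hlt : f j < f i := lt_of_le_of_ne (not_lt.1 hcon) hne.symm
    refine hjT (Finset.mem_insert_of_mem (hw2 j ?_ j.2))
    rw [mem_descentSet]
    refine ⟨Fin.castLE hmn i, Fin.castLE hmn j, by simpa using hij, by simp, ?_⟩
    rw [Fin.lt_def, hf, hf]
    rw [Fin.lt_def] at hlt
    omega
  choose Φ hΦ using hex
  refine Nat.card_eq_of_bijective Φ ⟨?_, ?_⟩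
  · intro w v hwv
    refine Subtype.ext (Equiv.ext fun q => ?_)
    by_cases hq : m ≤ (q : ℕ)
    · rw [w.2.1 q hq, v.2.1 q hq]
    · push Not at hq
      have e1 := hΦ w ⟨q, hq⟩
      have e2 := hΦ v ⟨q, hq⟩
      rw [hwv, ← e2] at e1
      exact Fin.ext e1
  · rintro ⟨w', hw'⟩
    let f : Fin n → Fin n := fun q => if h : (q : ℕ) < m then
      ⟨(n - m) + w' ⟨q, h⟩, by have := (w' ⟨q, h⟩).2; omega⟩ else wS q
    have hf1 : ∀ q : Fin n, ∀ h : (q : ℕ) < m, (f q : ℕ) = (n - m) + w' ⟨q, h⟩ := by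
      intro q h; simp [f, h]
    have hf2 : ∀ q : Fin n, m ≤ (q : ℕ) → f q = wS q := by
      intro q h; simp [f, not_lt.2 h]
    have hinj : Function.Injective f := by
      intro p q hpq
      rcases lt_or_ge (p : ℕ) m with hp | hp <;> rcases lt_or_ge (q : ℕ) m with hq | hq
      · have h1 := hf1 p hp
        rw [hpq, hf1 q hq] at h1
        have h2 : w' ⟨q, hq⟩ = w' ⟨p, hp⟩ := Fin.ext (by omega)
        have := w'.injective h2
        simp at this
        exact Fin.ext this.symm
      · have h1 := hf1 p hp
        have h2 := wS_low hwS hwSmax hm q hq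
        rw [hpq, hf2 q hq] at h1
        omega
      · have h1 := hf1 q hq
        have h2 := wS_low hwS hwSmax hm p hp
        rw [← hpq, hf2 p hp] at h1
        omega
      · rw [hf2 p hp, hf2 q hq] at hpq
        exact wS.injective hpq
    let w : Equiv.Perm (Fin n) := Equiv.ofBijective f (Finite.injective_iff_bijective.1 hinj)
    have hwT : ∀ d ∈ descentSet w, d < m → d ∈ T := by
      intro d hd hdm
      rw [mem_descentSet] at hd
      obtain ⟨i, j, h1, rfl, h3⟩ := hd
      by_contra hT
      have h4 := hw' ⟨i, by omega⟩ ⟨j, hdm⟩ h1 (by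
        simp only [Finset.mem_insert, not_or]; exact ⟨by omega, hT⟩)
      rw [Fin.lt_def] at h3 h4
      have e1 := hf1 i (by omega)
      have e2 := hf1 j hdm
      have e3 : (w i : ℕ) = f i := rfl
      have e4 : (w j : ℕ) = f j := rfl
      omega
    refine ⟨⟨w, hf2, hwT⟩, ?_⟩
    · refine Subtype.ext (Equiv.ext fun i => Fin.ext ?_)
      have h1 := hΦ ⟨w, hf2, hwT⟩ i
      have h2 := hf1 (Fin.castLE hmn i) (by simp)
      have e3 : (w (Fin.castLE hmn i) : ℕ) = f (Fin.castLE hmn i) := rfl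
      have e5 : (w (Fin.castLE hmn i) : ℕ) = (n - m) + w' i := e3.trans h2
      have e6 := h1.symm.trans e5
      change ((Φ ⟨w, hf2, hwT⟩).1 i : ℕ) = w' i
      omega

lemma agree_des
    {n : ℕ} {S : Finset ℕ} {wS : Equiv.Perm (Fin n)} (hwS : descentSet wS = S)
    (hwSmax : ∀ v : Equiv.Perm (Fin n), descentSet v = S → invCount v ≤ invCount wS)
    {m : ℕ} (hm : m ∈ insert 0 S) (hmn : m < n) {w : Equiv.Perm (Fin n)}
    (hw : agree wS m w) (h1 : ∀ d ∈ descentSet w, d < m → d ∈ S)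
    (h2 : ∀ d ∈ S, d < m → d ∈ descentSet w) : descentSet w = S := by
  have hgt : ∀ d, m < d → (d ∈ descentSet w ↔ d ∈ S) := by
    intro d hd
    rw [← hwS, mem_descentSet, mem_descentSet]
    refine exists_congr fun i => exists_congr fun j => and_congr_right fun hij => and_congr_right fun hdj => ?_
    rw [hw i (by omega), hw j (by omega)]
  ext d
  rcases lt_trichotomy d m with h | h | h
  · exact ⟨fun hd => h1 d hd h, fun hd => h2 d hd h⟩
  · subst h
    rcases Nat.eq_zero_or_pos d with h0 | h0
    · subst h0
      rw [← hwS, mem_descentSet, mem_descentSet]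
      constructor <;> rintro ⟨i, j, hij, h0, _⟩ <;> omega
    · have hdS : d ∈ S := by
        rcases Finset.mem_insert.1 hm with h | h
        · omega
        · exact h
      refine ⟨fun _ => hdS, fun _ => ?_⟩
      rw [mem_descentSet]
      refine ⟨⟨d - 1, by omega⟩, ⟨d, hmn⟩, by simp; omega, rfl, ?_⟩
      have e1 := agree_high hwS hwSmax hm hw ⟨d-1, by omega⟩ (by simp; omega)
      have e2 := wS_low hwS hwSmax hm ⟨d, hmn⟩ le_rfl
      rw [← hw ⟨d, hmn⟩ le_rfl] at e2
      rw [Fin.lt_def]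
      omega
  · exact hgt d h

end PartE


section PartF

lemma sElt_zero (n : ℕ) (S : Finset ℕ) : sElt n S 0 = 0 := by simp [sElt]

lemma sElt_succ (n : ℕ) (S : Finset ℕ) (i : Fin S.card) :
    sElt n S (i + 1) = S.orderEmbOfFin rfl i := by
  unfold sElt
  rw [if_neg (by omega), if_pos (by omega), Finset.orderEmbOfFin_apply]
  simp

lemma sElt_mem (n : ℕ) (S : Finset ℕ) (j : ℕ) (hj : j ≤ S.card) : sElt n S j ∈ insert 0 S := by
  rcases j with _ | j
  · rw [sElt_zero]; exact Finset.mem_insert_self _ _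
  · rw [sElt_succ n S ⟨j, hj⟩]
    exact Finset.mem_insert_of_mem (Finset.orderEmbOfFin_mem _ _ _)

lemma sElt_surj (n : ℕ) (S : Finset ℕ) (m : ℕ) (hm : m ∈ insert 0 S) :
    ∃ j ≤ S.card, sElt n S j = m := by
  rcases Finset.mem_insert.1 hm with rfl | hm
  · exact ⟨0, Nat.zero_le _, sElt_zero n S⟩
  · have : m ∈ Set.range (S.orderEmbOfFin rfl) := by
      rw [Finset.range_orderEmbOfFin]; exact hm
    obtain ⟨i, hi⟩ := this
    exact ⟨i + 1, i.2, by rw [sElt_succ, hi]⟩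

lemma sElt_card (n : ℕ) (S : Finset ℕ) (h0 : 0 ∉ S) (j : ℕ) (hj : j ≤ S.card) :
    (S.filter (fun s => sElt n S j < s)).card = S.card - j := by
  rcases j with _ | j
  · rw [sElt_zero, Finset.filter_true_of_mem, Nat.sub_zero]
    intro s hs
    exact Nat.pos_of_ne_zero fun h => h0 (h ▸ hs)
  · rw [sElt_succ n S ⟨j, hj⟩]
    have : S.filter (fun s => S.orderEmbOfFin rfl ⟨j, hj⟩ < s) =
        (Finset.Ioi (⟨j, hj⟩ : Fin S.card)).map (S.orderEmbOfFin rfl).toEmbedding := by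
      ext s
      simp only [Finset.mem_filter, Finset.mem_map, Finset.mem_Ioi]
      constructor
      · rintro ⟨h1, h2⟩
        have : s ∈ Set.range (S.orderEmbOfFin rfl) := by
          rw [Finset.range_orderEmbOfFin]; exact h1
        obtain ⟨i, rfl⟩ := this
        exact ⟨i, (S.orderEmbOfFin rfl).lt_iff_lt.1 h2, rfl⟩
      · rintro ⟨i, h1, rfl⟩
        exact ⟨Finset.orderEmbOfFin_mem _ _ _, (S.orderEmbOfFin rfl).lt_iff_lt.2 h1⟩
    rw [this, Finset.card_map, Fin.card_Ioi]
    simp only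
    omega

lemma sElt_mono (n : ℕ) (S : Finset ℕ) (hS : S ⊆ Finset.Icc 1 (n - 1)) :
    ∀ i j, i ≤ j → sElt n S i ≤ sElt n S j := by
  intro i j hij
  by_cases hj : S.card < j
  · rw [sElt_of_gt n S j hj]
    by_cases hi : S.card < i
    · rw [sElt_of_gt n S i hi]
    · rcases Finset.mem_insert.1 (sElt_mem n S i (not_lt.1 hi)) with h | h
      · omega
      · have := Finset.mem_Icc.1 (hS h); omega
  · rcases i with _ | i
    · rw [sElt_zero]; omega
    · rcases j with _ | j
      · omega
      · rw [sElt_succ n S ⟨i, by omega⟩, sElt_succ n S ⟨j, by omega⟩]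
        exact (S.orderEmbOfFin rfl).le_iff_le.2 (by rw [Fin.le_def]; simp only; omega)

/-! ### inclusion-exclusion -/

lemma incl_excl (U D : Finset ℕ) :
    (∑ T ∈ U.powerset, (-1 : ℤ) ^ (U \ T).card * if ∀ x ∈ U, x ∈ D → x ∈ T then 1 else 0) =
      if U ⊆ D then 1 else 0 := by
  have h := Finset.prod_add (fun _ : ℕ => (1 : ℤ)) (fun x => if x ∈ D then 0 else -1) U
  have e1 : (∏ x ∈ U, ((1 : ℤ) + if x ∈ D then 0 else -1)) = if U ⊆ D then 1 else 0 := by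
    split_ifs with hU
    · exact Finset.prod_eq_one fun x hx => by simp [hU hx]
    · obtain ⟨x, hx, hxD⟩ := Finset.not_subset.1 hU
      exact Finset.prod_eq_zero hx (by simp [hxD])
  rw [← e1, h]
  refine Finset.sum_congr rfl fun T hT => ?_
  rw [Finset.prod_const_one, one_mul]
  split_ifs with hc
  · rw [mul_one, ← Finset.prod_const]
    refine Finset.prod_congr rfl fun x hx => ?_
    rw [Finset.mem_sdiff] at hx
    rw [if_neg fun hD => hx.2 (hc x hx.1 hD)]
  · push Not at hc
    obtain ⟨x, h1, h2, h3⟩ := hc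
    rw [mul_zero]
    exact (Finset.prod_eq_zero (Finset.mem_sdiff.2 ⟨h1, h3⟩) (by simp [h2])).symm

lemma sup_mem_insert (S T : Finset ℕ) (hT : T ⊆ S) : T.sup id ∈ insert 0 S := by
  rcases T.eq_empty_or_nonempty with rfl | h
  · simp
  · obtain ⟨x, hx, hxe⟩ := Finset.exists_mem_eq_sup T h id
    rw [hxe]
    exact Finset.mem_insert_of_mem (hT hx)

lemma fiber_sum (S D : Finset ℕ) (h0 : 0 ∉ S) (m : ℕ) (hm : m ∈ insert 0 S) :
    (∑ T ∈ S.powerset with T.sup id = m, (-1 : ℤ) ^ (S.card - T.card) *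
      if ∀ d ∈ D, d < m → d ∈ T then 1 else 0) =
    (-1 : ℤ) ^ (S.filter (fun s => m < s)).card *
      if (∀ d ∈ D, d < m → d ∈ S) ∧ (∀ d ∈ S, d < m → d ∈ D) then 1 else 0 := by
  set U := S.filter (· < m) with hU
  have hcS : S.card = U.card + (S.filter (· = m)).card + (S.filter (fun s => m < s)).card := by
    rw [← Finset.card_union_of_disjoint, ← Finset.card_union_of_disjoint]
    · congr 1
      ext s
      simp only [hU, Finset.mem_union, Finset.mem_filter]
      have := lt_trichotomy s m
      tauto
    · rw [Finset.disjoint_left]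
      intro s
      simp only [hU, Finset.mem_union, Finset.mem_filter]
      omega
    · rw [Finset.disjoint_left]
      intro s
      simp only [hU, Finset.mem_filter]
      omega
  have step : (∑ T ∈ S.powerset with T.sup id = m, (-1 : ℤ) ^ (S.card - T.card) *
      if ∀ d ∈ D, d < m → d ∈ T then 1 else 0) =
      ∑ T ∈ U.powerset, (-1 : ℤ) ^ (S.filter (fun s => m < s)).card *
        ((-1 : ℤ) ^ (U \ T).card * if ∀ d ∈ D, d < m → d ∈ T then 1 else 0) := by
    symm
    refine Finset.sum_bij' (fun T _ => T ∪ S.filter (· = m)) (fun T _ => T.filter (· < m)) ?_ ?_ ?_ ?_ ?_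
    · intro T hT
      rw [Finset.mem_powerset] at hT
      rw [Finset.mem_filter, Finset.mem_powerset]
      constructor
      · intro s hs
        rcases Finset.mem_union.1 hs with h | h
        · exact (Finset.mem_filter.1 (hT h)).1
        · exact (Finset.mem_filter.1 h).1
      · apply le_antisymm
        · refine Finset.sup_le fun s hs => ?_
          rcases Finset.mem_union.1 hs with h | h
          · exact (Finset.mem_filter.1 (hT h)).2.le
          · exact (Finset.mem_filter.1 h).2.le
        · rcases Finset.mem_insert.1 hm with h | h
          · omega
          · exact Finset.le_sup (f := id)
              (Finset.mem_union_right _ (Finset.mem_filter.2 ⟨h, rfl⟩))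
    · intro T hT
      rw [Finset.mem_filter, Finset.mem_powerset] at hT
      rw [Finset.mem_powerset]
      exact Finset.filter_subset_filter _ hT.1
    · intro T hT
      rw [Finset.mem_powerset] at hT
      ext s
      simp only [Finset.mem_union, Finset.mem_filter]
      constructor
      · rintro ⟨h | h, h2⟩
        · exact h
        · omega
      · intro h
        exact ⟨Or.inl h, (Finset.mem_filter.1 (hT h)).2⟩
    · intro T hT
      rw [Finset.mem_filter, Finset.mem_powerset] at hT
      ext s
      simp only [Finset.mem_union, Finset.mem_filter]
      constructor
      · rintro (h | ⟨h1, h2⟩)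
        · exact h.1
        · subst h2
          have hne : T.Nonempty := by
            rw [Finset.nonempty_iff_ne_empty]
            rintro rfl
            have := hT.2
            simp at this
            exact h0 (this ▸ h1)
          obtain ⟨x, hx, hxe⟩ := Finset.exists_mem_eq_sup T hne id
          rw [← hT.2, hxe]
          exact hx
      · intro h
        have h1 : s ≤ m := by rw [← hT.2]; exact Finset.le_sup (f := id) h
        rcases lt_or_eq_of_le h1 with h2 | h2
        · exact Or.inl ⟨h, h2⟩
        · exact Or.inr ⟨hT.1 h, h2⟩
    · intro T hT
      rw [Finset.mem_powerset] at hT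
      have hc : (T ∪ S.filter (· = m)).card = T.card + (S.filter (· = m)).card := by
        apply Finset.card_union_of_disjoint
        rw [Finset.disjoint_left]
        intro s hs
        have := (Finset.mem_filter.1 (hT hs)).2
        simp only [Finset.mem_filter]
        omega
      have hc2 : (U \ T).card = U.card - T.card := Finset.card_sdiff_of_subset hT
      have hc3 := Finset.card_le_card hT
      rw [← mul_assoc, ← pow_add]
      congr 1
      · congr 1
        omega
      · congr 1
        refine propext (forall_congr' fun d => forall_congr' fun _ => forall_congr' fun hd => ?_)
        simp only [Finset.mem_union, Finset.mem_filter]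
        constructor
        · exact Or.inl
        · rintro (h | h)
          · exact h
          · omega
  rw [step, ← Finset.mul_sum]
  congr 1
  by_cases hDS : ∀ d ∈ D, d < m → d ∈ S
  · have := incl_excl U D
    have e2 : (U ⊆ D) ↔ ((∀ d ∈ D, d < m → d ∈ S) ∧ (∀ d ∈ S, d < m → d ∈ D)) := by
      constructor
      · intro h
        exact ⟨hDS, fun d hd hdm => h (Finset.mem_filter.2 ⟨hd, hdm⟩)⟩
      · rintro ⟨_, h⟩ d hd
        exact h d (Finset.mem_filter.1 hd).1 (Finset.mem_filter.1 hd).2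
    rw [if_congr e2 rfl rfl] at this
    rw [← this]
    refine Finset.sum_congr rfl fun T hT => ?_
    congr 1
    refine if_congr ?_ rfl rfl
    constructor
    · intro h x hx hxD
      exact h x hxD (Finset.mem_filter.1 hx).2
    · intro h d hd hdm
      exact h d (Finset.mem_filter.2 ⟨hDS d hd hdm, hdm⟩) hd
  · rw [if_neg (fun h => hDS h.1)]
    refine Finset.sum_eq_zero fun T hT => ?_
    rw [if_neg, mul_zero]
    intro h
    rw [Finset.mem_powerset] at hT
    exact hDS fun d hd hdm => (Finset.mem_filter.1 (hT (h d hd hdm))).1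

/-! ### the statistic tau -/

lemma agree_iff {n : ℕ} (wS w : Equiv.Perm (Fin n)) (m : ℕ) :
    (∀ x, m < x → x ≤ n → permApp w x = permApp wS x) ↔ agree wS m w := by
  constructor
  · intro h q hq
    have := h (q + 1) (by omega) q.2
    rw [permApp_succ, permApp_succ] at this
    exact Fin.ext (by omega)
  · intro h x h1 h2
    have := h ⟨x - 1, by omega⟩ (by simp only; omega)
    have e1 := permApp_succ w ⟨x - 1, by omega⟩
    have e2 := permApp_succ wS ⟨x - 1, by omega⟩
    rw [this, ← e2] at e1
    simp only at e1
    rwa [Nat.sub_add_cancel (by omega)] at e1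

lemma tau_iff {n : ℕ} {μ : YoungDiagram} (hμ : μ.card = n) (S : Finset ℕ)
    (hS : S ⊆ Finset.Icc 1 (n - 1)) (wS w : Equiv.Perm (Fin n)) (Q : SYT μ) (i : ℕ)
    (hi : i ≤ S.card + 1) :
    (agree wS (sElt n S (S.card + 1 - i)) w ∧ desOK (sElt n S (S.card + 1 - i)) Q) ↔
      i ≤ tau n S wS w Q := by
  have hP : ∀ i, ((∀ x, sElt n S (S.card + 1 - i) < x → x ≤ n → permApp w x = permApp wS x) ∧
      (∀ d ∈ Q.des, n - sElt n S (S.card + 1 - i) ≤ d)) ↔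
      (agree wS (sElt n S (S.card + 1 - i)) w ∧ desOK (sElt n S (S.card + 1 - i)) Q) := by
    intro i
    rw [agree_iff]
    refine and_congr_right fun _ => forall_congr' fun d => forall_congr' fun _ => ?_
    omega
  rw [← hP]
  constructor
  · intro h
    unfold tau
    exact Finset.le_max' _ _ (Finset.mem_filter.2 ⟨Finset.mem_range.2 (by omega), h⟩)
  · intro h
    have hmem : tau n S wS w Q ∈ (Finset.range (S.card + 2)).filter
      (fun i => (∀ x, sElt n S (S.card + 1 - i) < x → x ≤ n → permApp w x = permApp wS x) ∧
      (∀ d ∈ Q.des, n - sElt n S (S.card + 1 - i) ≤ d)) := Finset.max'_mem _ _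
    obtain ⟨h1, h2, h3⟩ := Finset.mem_filter.1 hmem
    have hm := sElt_mono n S hS (S.card + 1 - tau n S wS w Q) (S.card + 1 - i) (by omega)
    refine ⟨fun x hx hxn => h2 x (by omega) hxn, fun d hd => ?_⟩
    have := h3 d hd
    omega

lemma tau_le {n : ℕ} {μ : YoungDiagram} (S : Finset ℕ) (wS w : Equiv.Perm (Fin n)) (Q : SYT μ) :
    tau n S wS w Q ≤ S.card + 1 := by
  have hmem : tau n S wS w Q ∈ (Finset.range (S.card + 2)).filter
      (fun i => (∀ x, sElt n S (S.card + 1 - i) < x → x ≤ n → permApp w x = permApp wS x) ∧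
      (∀ d ∈ Q.des, n - sElt n S (S.card + 1 - i) ≤ d)) := Finset.max'_mem _ _
  have := Finset.mem_range.1 (Finset.mem_filter.1 hmem).1
  omega

lemma tau_sum {n : ℕ} {μ : YoungDiagram} (hμ : μ.card = n) (S : Finset ℕ)
    (hS : S ⊆ Finset.Icc 1 (n - 1)) (h0 : 0 ∉ S) (wS w : Equiv.Perm (Fin n)) (Q : SYT μ) :
    (∑ m ∈ insert 0 S, (-1 : ℤ) ^ (S.filter (fun s => m < s)).card *
      if agree wS m w ∧ desOK m Q then 1 else 0) = if Odd (tau n S wS w Q) then 1 else 0 := by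
  have h1 : (∑ i ∈ Finset.range (S.card + 1), (-1 : ℤ) ^ i * if i + 1 ≤ tau n S wS w Q then 1 else 0) =
      ∑ m ∈ insert 0 S, (-1 : ℤ) ^ (S.filter (fun s => m < s)).card *
      if agree wS m w ∧ desOK m Q then 1 else 0 := by
    refine Finset.sum_bij (fun i _ => sElt n S (S.card - i)) ?_ ?_ ?_ ?_
    · intro i _
      exact sElt_mem n S _ (by omega)
    · intro i hi j hj hij
      rw [Finset.mem_range] at hi hj
      have e1 := sElt_card n S h0 (S.card - i) (by omega)
      have e2 := sElt_card n S h0 (S.card - j) (by omega)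
      rw [hij, e2] at e1
      omega
    · intro m hm
      obtain ⟨j, hj, rfl⟩ := sElt_surj n S m hm
      exact ⟨S.card - j, Finset.mem_range.2 (by omega), by
        congr 1; omega⟩
    · intro i hi
      rw [Finset.mem_range] at hi
      have e1 := sElt_card n S h0 (S.card - i) (by omega)
      rw [e1]
      congr 1
      · congr 1; omega
      · refine if_congr ?_ rfl rfl
        rw [← tau_iff hμ S hS wS w Q (i+1) (by omega)]
        rw [show S.card + 1 - (i + 1) = S.card - i by omega]
  rw [← h1]
  simp only [mul_ite, mul_one, mul_zero]
  rw [← Finset.sum_filter]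
  have h2 : (Finset.range (S.card + 1)).filter (fun i => i + 1 ≤ tau n S wS w Q) =
      Finset.range (tau n S wS w Q) := by
    have := tau_le S wS w Q
    ext i
    simp only [Finset.mem_filter, Finset.mem_range]
    omega
  rw [h2, neg_one_geom_sum]
  by_cases h : Even (tau n S wS w Q)
  · rw [if_pos h, if_neg (Nat.not_odd_iff_even.2 h)]
  · rw [if_neg h, if_pos (Nat.not_even_iff_odd.1 h)]

lemma nat_card_eq_sum {α : Type*} [Fintype α] (p : α → Prop) :
    (Nat.card {x // p x} : ℤ) = ∑ x, if p x then 1 else 0 := by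
  rw [Nat.card_eq_fintype_card, card_eq_sum_ite]

lemma pair_sum {n : ℕ} {μ : YoungDiagram} (hn : 0 < n) (hμ : μ.card = n) (S : Finset ℕ)
    (hS : S ⊆ Finset.Icc 1 (n - 1)) {wS : Equiv.Perm (Fin n)} (hwS : descentSet wS = S)
    (hwSmax : ∀ v : Equiv.Perm (Fin n), descentSet v = S → invCount v ≤ invCount wS)
    (w : Equiv.Perm (Fin n)) (Q : SYT μ) :
    (∑ T ∈ S.powerset, (-1 : ℤ) ^ (S.card - T.card) *
      ((if agree wS (T.sup id) w ∧ ∀ d ∈ descentSet w, d < T.sup id → d ∈ T then 1 else 0) *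
        if desOK (T.sup id) Q then 1 else 0)) =
    if descentSet w = S ∧ Odd (tau n S wS w Q) then 1 else 0 := by
  have h0 : 0 ∉ S := fun h => by have := Finset.mem_Icc.1 (hS h); omega
  rw [← Finset.sum_fiberwise_of_maps_to (t := insert 0 S) (g := fun T : Finset ℕ => T.sup id)
    (fun T hT => sup_mem_insert S T (Finset.mem_powerset.1 hT))]
  have h1 : ∀ m ∈ insert 0 S, (∑ T ∈ S.powerset with T.sup id = m, (-1 : ℤ) ^ (S.card - T.card) *
      ((if agree wS (T.sup id) w ∧ ∀ d ∈ descentSet w, d < T.sup id → d ∈ T then 1 else 0) *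
        if desOK (T.sup id) Q then 1 else 0)) =
      (if descentSet w = S then 1 else 0) * ((-1 : ℤ) ^ (S.filter (fun s => m < s)).card *
      if agree wS m w ∧ desOK m Q then 1 else 0) := by
    intro m hm
    have hmn : m < n := by
      rcases Finset.mem_insert.1 hm with h | h
      · omega
      · have := Finset.mem_Icc.1 (hS h); omega
    have e : ∀ T ∈ S.powerset.filter (fun T : Finset ℕ => T.sup id = m), (-1 : ℤ) ^ (S.card - T.card) *
      ((if agree wS (T.sup id) w ∧ ∀ d ∈ descentSet w, d < T.sup id → d ∈ T then 1 else 0) *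
        if desOK (T.sup id) Q then 1 else 0) = ((-1 : ℤ) ^ (S.card - T.card) *
        if ∀ d ∈ descentSet w, d < m → d ∈ T then 1 else 0) * (if agree wS m w ∧ desOK m Q then 1 else 0) := by
      intro T hT
      rw [(Finset.mem_filter.1 hT).2, mul_assoc]
      congr 1
      by_cases ha : agree wS m w <;> by_cases hd : desOK m Q <;> simp [ha, hd]
    rw [Finset.sum_congr rfl e, ← Finset.sum_mul, fiber_sum S _ h0 m hm]
    by_cases ha : agree wS m w
    · have : ((∀ d ∈ descentSet w, d < m → d ∈ S) ∧ (∀ d ∈ S, d < m → d ∈ descentSet w)) ↔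
          descentSet w = S := by
        constructor
        · rintro ⟨h1, h2⟩
          exact agree_des hwS hwSmax hm hmn ha h1 h2
        · intro h
          rw [h]
          exact ⟨fun d hd _ => hd, fun d hd _ => hd⟩
      rw [if_congr this rfl rfl]
      ring
    · rw [if_neg (fun h : agree wS m w ∧ desOK m Q => ha h.1)]
      ring
  rw [Finset.sum_congr rfl h1, ← Finset.mul_sum, tau_sum hμ S hS h0]
  by_cases hd : descentSet w = S <;> simp [hd]

end PartF


section PartG

lemma alpha_sum {n : ℕ} {μ : YoungDiagram} (hn : 0 < n) (hμ : μ.card = n) (S : Finset ℕ)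
    (hS : S ⊆ Finset.Icc 1 (n - 1)) {wS : Equiv.Perm (Fin n)} (hwS : descentSet wS = S)
    (hwSmax : ∀ v : Equiv.Perm (Fin n), descentSet v = S → invCount v ≤ invCount wS)
    (T : Finset ℕ) (hT : T ⊆ S) :
    (∑ g : Equiv.Perm (Fin n), injAlpha n T g * chi n μ g⁻¹) =
      (n.factorial : ℤ) * ∑ w : Equiv.Perm (Fin n), ∑ Q : SYT μ,
      ((if agree wS (T.sup id) w ∧ ∀ d ∈ descentSet w, d < T.sup id → d ∈ T then 1 else 0) *
        if desOK (T.sup id) Q then 1 else 0) := by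
  have hSn : ∀ t ∈ S, t ≤ n := fun t ht => by have := Finset.mem_Icc.1 (hS ht); omega
  have hmS := sup_mem_insert S T hT
  have hmn : T.sup id ≤ n := Finset.sup_le fun t ht => hSn t (hT ht)
  have hmT := sup_mem_insert T T (Finset.Subset.refl _)
  have hle : ∀ t ∈ insert 0 T, t ≤ T.sup id := by
    intro t ht
    rcases Finset.mem_insert.1 ht with rfl | h
    · exact Nat.zero_le _
    · exact Finset.le_sup (f := id) h
  have h1 : ∀ g : Equiv.Perm (Fin n), injAlpha n T g * chi n μ g⁻¹ =
      (Nat.card {w : Equiv.Perm (Fin n) // agree wS (T.sup id) w ∧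
        ∀ d ∈ descentSet w, d < T.sup id → d ∈ T} : ℤ) *
      ((Fintype.card {u : Fin (T.sup id) ↪ Fin n // ∀ j, g (u j) = u j} : ℤ) * chi n μ g⁻¹) := by
    intro g
    rw [injAlpha_eq T (fun t ht => hSn t (hT ht)), card_Fam (insert 0 T) hle hmT,
      card_pDes hwS hwSmax hmn hmS]
    push_cast
    ring
  rw [Finset.sum_congr rfl fun g _ => h1 g, ← Finset.mul_sum, sum_H_chi n _ μ hμ hmn,
    nat_card_eq_sum, mul_left_comm, fS, Finset.sum_mul_sum]
  refine congrArg _ (Finset.sum_congr rfl fun w _ => Finset.sum_congr rfl fun Q _ => ?_)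
  congr

end PartG

/-- **Theorem 1.2(a)**: `b_λ(S)` equals the number of pairs `(w,Q)` with `w ∈ 𝔖_n` of
descent set `S` and `Q` a standard Young tableau of shape `λ` with `τ(w,Q)` odd. -/
theorem statement1 (n : ℕ) (hn : 0 < n) (μ : YoungDiagram) (hμ : μ.card = n)
    (S : Finset ℕ) (hS : S ⊆ Finset.Icc 1 (n - 1))
    (wS : Equiv.Perm (Fin n)) (hwS : descentSet wS = S)
    (hwSmax : ∀ v : Equiv.Perm (Fin n), descentSet v = S → invCount v ≤ invCount wS) :
    (∑ g : Equiv.Perm (Fin n), injBeta n S g * chi n μ g⁻¹) =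
      (Nat.card {p : Equiv.Perm (Fin n) × SYT μ //
          descentSet p.1 = S ∧ Odd (tau n S wS p.1 p.2)} : ℤ) * (n.factorial : ℤ) := by
  have hb : ∀ g : Equiv.Perm (Fin n), injBeta n S g * chi n μ g⁻¹ =
      ∑ T ∈ S.powerset, (-1 : ℤ) ^ (S.card - T.card) * (injAlpha n T g * chi n μ g⁻¹) := by
    intro g
    unfold injBeta gBeta
    rw [Finset.sum_mul]
    refine Finset.sum_congr rfl fun T _ => ?_
    rw [mul_assoc]
    rfl
  rw [Finset.sum_congr rfl fun g _ => hb g, Finset.sum_comm]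
  have h2 : ∀ T ∈ S.powerset, (∑ g : Equiv.Perm (Fin n),
      (-1 : ℤ) ^ (S.card - T.card) * (injAlpha n T g * chi n μ g⁻¹)) =
      ∑ w : Equiv.Perm (Fin n), ∑ Q : SYT μ, (n.factorial : ℤ) * ((-1 : ℤ) ^ (S.card - T.card) *
      ((if agree wS (T.sup id) w ∧ ∀ d ∈ descentSet w, d < T.sup id → d ∈ T then 1 else 0) *
        if desOK (T.sup id) Q then 1 else 0)) := by
    intro T hT
    rw [← Finset.mul_sum, alpha_sum hn hμ S hS hwS hwSmax T (Finset.mem_powerset.1 hT)]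
    simp_rw [Finset.mul_sum]
    refine Finset.sum_congr rfl fun w _ => Finset.sum_congr rfl fun Q _ => ?_
    ring
  rw [Finset.sum_congr rfl h2, Finset.sum_comm, nat_card_eq_sum, Fintype.sum_prod_type,
    Finset.sum_mul]
  refine Finset.sum_congr rfl fun w _ => ?_
  rw [Finset.sum_comm, Finset.sum_mul]
  refine Finset.sum_congr rfl fun Q _ => ?_
  rw [← Finset.mul_sum, pair_sum hn hμ S hS hwS hwSmax, mul_comm]
  congr
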